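/- arXiv:1402.3006 — 3 statements merged into one kernel-verified Lean document; each statement's English description precedes it below -/
import Mathlib

section
/- Let F ∈ 𝔉, let u ∈ W¹₁(-1,1) be nonnegative with u(-1) = 0, and let the weight a : [-1,1] × [0,∞) → [0,∞) be continuous and satisfy condition (C) (no evenness in the first argument is assumed). Then I(a,u*) ≤ I(a,u). -/
open MeasureTheory Set Filter
open scoped ENNReal BigOperators NNReal

noncomputable section

/-- `u ∈ W¹₁(-1,1)`: `u` is absolutely continuous on `[-1,1]` with (a.e.) derivative in `L¹`,
encoded via the fundamental theorem of calculus with the pointwise derivative `deriv u`. -/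
def MemW11 (u : ℝ → ℝ) : Prop :=
  IntegrableOn (deriv u) (Icc (-1 : ℝ) 1) volume ∧
  ∀ x ∈ Icc (-1 : ℝ) 1, u x = u (-1) + ∫ t in (-1 : ℝ)..x, deriv u t

/-- Convergence `u_k → u` in `W¹₁(-1,1)`. -/
def W11Tendsto (uk : ℕ → ℝ → ℝ) (u : ℝ → ℝ) : Prop :=
  Tendsto (fun k => ∫ x in Icc (-1 : ℝ) 1, (|uk k x - u x| + |deriv (uk k) x - deriv u x|))
    atTop (nhds 0)

/-- `F ∈ 𝔉`: continuous, nonnegative, convex and nondecreasing in the second argument. -/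
def MemFrakF (F : ℝ → ℝ → ℝ) : Prop :=
  ContinuousOn (fun p : ℝ × ℝ => F p.1 p.2) (Ici (0 : ℝ) ×ˢ Ici (0 : ℝ)) ∧
  (∀ v p : ℝ, 0 ≤ v → 0 ≤ p → 0 ≤ F v p) ∧
  (∀ v : ℝ, 0 ≤ v → ConvexOn ℝ (Ici (0 : ℝ)) (F v)) ∧
  (∀ v : ℝ, 0 ≤ v → MonotoneOn (F v) (Ici (0 : ℝ)))

/-- A continuous nonnegative weight on `[-1,1] × [0,∞)`. -/
def Weight (a : ℝ → ℝ → ℝ) : Prop :=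
  ContinuousOn (fun p : ℝ × ℝ => a p.1 p.2) (Icc (-1 : ℝ) 1 ×ˢ Ici (0 : ℝ)) ∧
  ∀ x v : ℝ, x ∈ Icc (-1 : ℝ) 1 → 0 ≤ v → 0 ≤ a x v

/-- Condition (C): `a(s,v) + a(t,v) ≥ a(1 - t + s, v)` for `-1 ≤ s ≤ t ≤ 1`, `v ≥ 0`. -/
def CondC (a : ℝ → ℝ → ℝ) : Prop :=
  ∀ s t v : ℝ, -1 ≤ s → s ≤ t → t ≤ 1 → 0 ≤ v → a (1 - t + s) v ≤ a s v + a t v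

/-- Condition (C) for a one-variable weight. -/
def CondC1 (a : ℝ → ℝ) : Prop :=
  ∀ s t : ℝ, -1 ≤ s → s ≤ t → t ≤ 1 → a (1 - t + s) ≤ a s + a t

/-- Condition (C'): `a(s,v) + a(t,v) ≥ a((s-t)/2, v) + a((t-s)/2, v)`. -/
def CondC' (a : ℝ → ℝ → ℝ) : Prop :=
  ∀ s t v : ℝ, s ∈ Icc (-1 : ℝ) 1 → t ∈ Icc (-1 : ℝ) 1 → 0 ≤ v →
    a ((s - t) / 2) v + a ((t - s) / 2) v ≤ a s v + a t v

/-- The functional `I(a,u) = ∫_{-1}^1 F(u(x), a(x,u(x))·|u'(x)|) dx ∈ [0,∞]`. -/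
def Ifun (F a : ℝ → ℝ → ℝ) (u : ℝ → ℝ) : ℝ≥0∞ :=
  ∫⁻ x in Icc (-1 : ℝ) 1, ENNReal.ofReal (F (u x) (a x (u x) * |deriv u x|))

/-- The monotone rearrangement `u*(x) = ∫₀^∞ χ_{[1-|A_t|,1]}(x) dt`,
where `A_t = {y ∈ [-1,1] : u(y) > t}`. -/
def mrear (u : ℝ → ℝ) (x : ℝ) : ℝ :=
  ∫ t in Ioi (0 : ℝ),
    (Icc (1 - (volume {y ∈ Icc (-1 : ℝ) 1 | u y > t}).toReal) 1).indicator
      (fun _ => (1 : ℝ)) x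

/-- The symmetric rearrangement `ū(x) = ∫₀^∞ χ_{[-|A_t|/2, |A_t|/2]}(x) dt`. -/
def srear (u : ℝ → ℝ) (x : ℝ) : ℝ :=
  ∫ t in Ioi (0 : ℝ),
    (Icc (-((volume {y ∈ Icc (-1 : ℝ) 1 | u y > t}).toReal / 2))
        ((volume {y ∈ Icc (-1 : ℝ) 1 | u y > t}).toReal / 2)).indicator
      (fun _ => (1 : ℝ)) x

/-- `u` is piecewise linear on `[-1,1]`: there is a partition `-1 = x₀ < ⋯ < x_n = 1`
such that `u` is affine on each `[x_i, x_{i+1}]`. -/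
def PiecewiseLinear (u : ℝ → ℝ) : Prop :=
  ∃ n : ℕ, ∃ x : Fin (n + 1) → ℝ, x 0 = -1 ∧ x (Fin.last n) = 1 ∧ StrictMono x ∧
    ∀ i : Fin n, ∃ c d : ℝ, ∀ y ∈ Icc (x i.castSucc) (x i.succ), u y = c * y + d

lemma filter_lt_nonempty_of_zeros {f : ℝ → ℝ} (hf : Continuous f) {K : Finset ℝ}
    (hK : ∀ x ∈ Icc (-1 : ℝ) 1, f x = 0 ↔ x ∈ K) {z : ℝ} (hz : -1 ≤ z) (hfz : f z < 0)
    (hpos : 0 < volume.real (Icc z 1 ∩ {x | 0 < f x})) : (K.filter (z < ·)).Nonempty := by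
  have hne : (Icc z 1 ∩ {x | 0 < f x}).Nonempty := by
    by_contra h
    rw [not_nonempty_iff_eq_empty] at h
    simp [h] at hpos
  obtain ⟨y, hy, hfy⟩ := hne
  obtain ⟨x, hx, hfx⟩ := intermediate_value_Icc hy.1 hf.continuousOn
    (show (0 : ℝ) ∈ Icc (f z) (f y) from ⟨hfz.le, le_of_lt hfy⟩)
  have hxz : z < x := lt_of_le_of_ne hx.1 (by rintro rfl; linarith)
  exact ⟨x, Finset.mem_filter.2
    ⟨(hK x ⟨by linarith, by linarith [hx.2, hy.2]⟩).1 hfx, hxz⟩⟩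

/-- Merging, by condition (C), the endpoints of the components of `{f > 0}` to the right of `z`. -/
lemma condC1_le_sum_zeros {b : ℝ → ℝ} (hb : ∀ x ∈ Icc (-1 : ℝ) 1, 0 ≤ b x) (hC : CondC1 b)
    (K : Finset ℝ) (hK1 : ∀ x ∈ K, x ∈ Icc (-1 : ℝ) 1) (n : ℕ) :
    ∀ (f : ℝ → ℝ), Continuous f → (∀ x ∈ Icc (-1 : ℝ) 1, f x = 0 ↔ x ∈ K) →
    ∀ z ∈ Icc (-1 : ℝ) 1, (K.filter (z < ·)).card ≤ n → f z < 0 →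
    0 < volume.real (Icc z 1 ∩ {x | 0 < f x}) →
    b (1 - volume.real (Icc z 1 ∩ {x | 0 < f x})) ≤ ∑ x ∈ K.filter (z < ·), b x := by
  induction n with
  | zero =>
    intro f hf hK z hz hn hfz hpos
    exact absurd (Finset.card_pos.2 (filter_lt_nonempty_of_zeros hf hK hz.1 hfz hpos)) (by omega)
  | succ n ih =>
    intro f hf hK z hz hn hfz hpos
    have hne := filter_lt_nonempty_of_zeros hf hK hz.1 hfz hpos
    obtain ⟨x, hxK, hxmin⟩ := (K.filter (z < ·)).exists_min_image id hne
    rw [Finset.mem_filter] at hxK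
    obtain ⟨hxK, hzx⟩ := hxK
    have hx1 := hK1 x hxK
    have hfx : f x = 0 := (hK x hx1).2 hxK
    have hneg : ∀ y ∈ Ico z x, f y < 0 := by
      intro y hy
      by_contra hfy
      push Not at hfy
      obtain ⟨x', hx', hfx'⟩ := intermediate_value_Icc hy.1 hf.continuousOn
        (show (0 : ℝ) ∈ Icc (f z) (f y) from ⟨hfz.le, hfy⟩)
      have hxz : z < x' := lt_of_le_of_ne hx'.1 (by rintro rfl; linarith)
      have := hxmin x' (Finset.mem_filter.2
        ⟨(hK x' ⟨by linarith [hz.1], by linarith [hx'.2, hy.2, hx1.2]⟩).1 hfx', hxz⟩)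
      simp only [id] at this
      linarith [hx'.2, hy.2]
    have hx_lt : x < 1 := by
      by_contra hx
      have hx : x = 1 := le_antisymm hx1.2 (not_lt.mp hx)
      have : Icc z 1 ∩ {x | 0 < f x} = ∅ := by
        ext y
        simp only [mem_inter_iff, mem_ofPred_eq, mem_empty_iff_false, iff_false]
        rintro ⟨hy, hfy⟩
        rcases hy.2.lt_or_eq with h | h
        · linarith [hneg y ⟨hy.1, by linarith⟩]
        · rw [h, ← hx, hfx] at hfy; exact lt_irrefl _ hfy
      rw [this] at hpos
      simp at hpos
    obtain ⟨w, hxw, hw1, hwK⟩ : ∃ w, x < w ∧ w ≤ 1 ∧ ∀ y ∈ Ioc x w, y ∉ K := by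
      have h1 : ((K.erase x : Finset ℝ) : Set ℝ)ᶜ ∈ nhds x :=
        (K.erase x).finite_toSet.isClosed.isOpen_compl.mem_nhds (by simp)
      obtain ⟨w, hw, hsub⟩ := mem_nhdsGT_iff_exists_Ioc_subset.1 (mem_nhdsWithin_of_mem_nhds h1)
      refine ⟨min w 1, lt_min hw hx_lt, min_le_right _ _, fun y hy hyK => ?_⟩
      have := hsub ⟨hy.1, hy.2.trans (min_le_left _ _)⟩
      exact this (Finset.mem_coe.2 (Finset.mem_erase.2 ⟨hy.1.ne', hyK⟩))
    have hwI : w ∈ Icc (-1 : ℝ) 1 := ⟨by linarith [hx1.1], hw1⟩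
    have hfw : f w ≠ 0 := fun h => hwK w ⟨hxw, le_rfl⟩ ((hK w hwI).1 h)
    have hsubw : K.filter (w < ·) ⊆ (K.filter (z < ·)).erase x := by
      intro y hy
      rw [Finset.mem_filter] at hy
      rw [Finset.mem_erase, Finset.mem_filter]
      exact ⟨by rintro rfl; linarith [hy.2], hy.1, by linarith [hy.2]⟩
    have hxmem : x ∈ K.filter (z < ·) := Finset.mem_filter.2 ⟨hxK, hzx⟩
    have hcard : (K.filter (w < ·)).card ≤ n := by
      have h1 := Finset.card_le_card hsubw
      rw [Finset.card_erase_of_mem hxmem] at h1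
      omega
    have hsum : b x + ∑ y ∈ K.filter (w < ·), b y ≤ ∑ y ∈ K.filter (z < ·), b y := by
      rw [← Finset.add_sum_erase _ _ hxmem]
      refine (add_le_add_iff_left _).2 (Finset.sum_le_sum_of_subset_of_nonneg hsubw
        fun y hy _ => hb y (hK1 y (Finset.mem_filter.1 (Finset.mem_of_mem_erase hy)).1))
    have hbx := hb x hx1
    have hsign : ∀ y ∈ Ioc x w, 0 < f y * f w := by
      intro y hy
      by_contra hle
      push Not at hle
      have hmem : (0 : ℝ) ∈ uIcc (f y) (f w) := by
        rw [mem_uIcc]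
        rcases lt_or_gt_of_ne hfw with h | h
        · right; exact ⟨h.le, by nlinarith⟩
        · left; exact ⟨by nlinarith, h.le⟩
      obtain ⟨x', hx', hfx'⟩ := intermediate_value_uIcc hf.continuousOn hmem
      rw [uIcc_of_le hy.2] at hx'
      exact hwK x' ⟨hy.1.trans_le hx'.1, hx'.2⟩
        ((hK x' ⟨by linarith [hx'.1, hy.1, hx1.1], by linarith [hx'.2]⟩).1 hfx')
    rcases lt_or_gt_of_ne hfw with h | h
    · have heq : Icc z 1 ∩ {x | 0 < f x} = Icc w 1 ∩ {x | 0 < f x} := by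
        ext y
        simp only [mem_inter_iff, mem_ofPred_eq, mem_Icc]
        refine ⟨fun ⟨⟨h1, h2⟩, h3⟩ => ⟨⟨?_, h2⟩, h3⟩, fun ⟨⟨h1, h2⟩, h3⟩ => ⟨⟨by linarith, h2⟩, h3⟩⟩
        by_contra hyw
        push Not at hyw
        rcases lt_trichotomy y x with h4 | rfl | h4
        · linarith [hneg y ⟨h1, h4⟩]
        · linarith
        · nlinarith [hsign y ⟨h4, hyw.le⟩]
      rw [heq] at hpos ⊢
      have := ih f hf hK w hwI hcard h hpos
      linarith
    · have hmeas : MeasurableSet {y | -f y > 0} := (isOpen_lt continuous_const hf.neg).measurableSet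
      have hvol : volume.real (Icc z 1 ∩ {x | 0 < f x})
          = 1 - x - volume.real (Icc w 1 ∩ {x | 0 < -f x}) := by
        have h1 : volume.real (Icc z 1 ∩ {x | 0 < f x})
            = volume.real (Icc x 1 \ (Icc w 1 ∩ {x | 0 < -f x})) := by
          have hnull : volume (K : Set ℝ) = 0 := K.finite_toSet.measure_zero _
          refine measureReal_congr ?_
          have hae : ∀ᵐ y, y ∉ (K : Set ℝ) := measure_eq_zero_iff_ae_notMem.1 hnull
          filter_upwards [hae] with y hy
          apply propext
          change (y ∈ Icc z 1 ∩ {x | 0 < f x}) ↔ y ∈ (Icc x 1 \ (Icc w 1 ∩ {x | 0 < -f x}))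
          simp only [Set.mem_sdiff, mem_inter_iff, mem_ofPred_eq, mem_Icc, not_and, not_lt]
          constructor
          · rintro ⟨⟨h1, h2⟩, h3⟩
            refine ⟨⟨?_, h2⟩, fun _ => by linarith⟩
            by_contra hyx
            linarith [hneg y ⟨h1, not_le.mp hyx⟩]
          · rintro ⟨⟨h1, h2⟩, h3⟩
            refine ⟨⟨by linarith, h2⟩, ?_⟩
            have hyx : x < y := lt_of_le_of_ne h1 (by rintro rfl; exact hy hxK)
            rcases le_or_gt w y with h4 | h4
            · have h5 := h3 ⟨h4, h2⟩
              have h6 : f y ≠ 0 := fun h6 => hy ((hK y ⟨by linarith [hx1.1], h2⟩).1 h6)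
              exact lt_of_le_of_ne (by linarith) h6.symm
            · nlinarith [hsign y ⟨hyx, h4.le⟩]
        have hsub : Icc w 1 ∩ {x | 0 < -f x} ⊆ Icc x 1 :=
          fun y hy => ⟨hxw.le.trans hy.1.1, hy.1.2⟩
        rw [h1, measureReal_sdiff hsub (measurableSet_Icc.inter hmeas)
          (by simp)]
        rw [Real.volume_real_Icc_of_le hx1.2]
      rw [hvol]
      have hge : 0 ≤ volume.real (Icc w 1 ∩ {x | 0 < -f x}) := measureReal_nonneg
      rcases hge.lt_or_eq with hlt | heq
      · have h1 := ih (fun y => -f y) hf.neg (fun y hy => by rw [neg_eq_zero]; exact hK y hy) w hwI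
          hcard (by linarith) hlt
        set m := volume.real (Icc w 1 ∩ {x | 0 < -f x})
        have hm : m ≤ 1 - w := by
          have := measureReal_mono (μ := volume) (inter_subset_left :
            Icc w 1 ∩ {x | 0 < -f x} ⊆ Icc w 1) (by simp)
          rwa [Real.volume_real_Icc_of_le hw1] at this
        have h2 := hC x (1 - m) hx1.1 (by linarith) (by linarith)
        have h3 : 1 - (1 - x - m) = 1 - (1 - m) + x := by ring
        rw [h3]
        linarith
      · rw [← heq]
        have h3 : 1 - (1 - x - 0) = x := by ring
        rw [h3]
        have : 0 ≤ ∑ y ∈ K.filter (w < ·), b y :=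
          Finset.sum_nonneg (fun y hy => hb y (hK1 y (Finset.mem_filter.1 hy).1))
        linarith

/-- The image of `s` under `U` is no larger than the `g`-mass of `s` when `∫ g` bounds the
increments of `U`. -/
lemma volume_image_le_withDensity {U g : ℝ → ℝ} (hg : Integrable g) (hg0 : ∀ x, 0 ≤ g x)
    (hU : ∀ x y, x ≤ y → |U y - U x| ≤ ∫ t in x..y, g t) (s : Set ℝ) :
    volume (U '' s) ≤ volume.withDensity (fun x => ENNReal.ofReal (g x)) s := by
  have hint : ∀ a b, IntervalIntegrable g volume a b := fun a b => hg.intervalIntegrable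
  have hcont : Continuous fun x => ∫ t in (0 : ℝ)..x, g t :=
    intervalIntegral.continuous_primitive hint 0
  have hdiff : ∀ a b, (∫ t in (0 : ℝ)..b, g t) - (∫ t in (0 : ℝ)..a, g t) = ∫ t in a..b, g t :=
    fun a b => intervalIntegral.integral_interval_sub_left (hint _ _) (hint _ _)
  let f : StieltjesFunction ℝ :=
    { toFun := fun x => ∫ t in (0 : ℝ)..x, g t
      mono' := fun a b hab => by
        have h1 := hdiff a b
        have h2 := intervalIntegral.integral_nonneg (μ := volume) hab (fun t _ => hg0 t)
        linarith
      right_continuous' := fun x => hcont.continuousWithinAt }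
  have hf : ∀ x, f x = ∫ t in (0 : ℝ)..x, g t := fun x => rfl
  have hmeas : f.measure = volume.withDensity (fun x => ENNReal.ofReal (g x)) := by
    refine Measure.ext_of_Ioc _ _ fun a b hab => ?_
    rw [f.measure_Ioc, withDensity_apply _ measurableSet_Ioc, hf, hf, hdiff,
      intervalIntegral.integral_of_le hab.le,
      ofReal_integral_eq_lintegral_ofReal hg.integrableOn (ae_of_all _ hg0)]
  have houter : OuterMeasure.comap U (volume : Measure ℝ).toOuterMeasure ≤ f.outer := by
    refine OuterMeasure.le_ofFunction.2 fun s => ?_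
    rw [OuterMeasure.comap_apply, f.length_eq]
    refine le_iInf fun a => le_iInf fun b => le_iInf fun hab => ?_
    have hsab : s ⊆ Ioc a b := fun x hx => hab ⟨hx, notMem_botSet_of_lt (sub_one_lt x)⟩
    refine (Real.volume_le_diam _).trans (Metric.ediam_le ?_)
    have key : ∀ x ∈ s, ∀ y ∈ s, x ≤ y → edist (U x) (U y) ≤ ENNReal.ofReal (f b - f a) := by
      intro x hx y hy hxy
      rw [edist_dist, dist_comm, Real.dist_eq]
      refine ENNReal.ofReal_le_ofReal ((hU x y hxy).trans ?_)
      rw [← hdiff, ← hf, ← hf]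
      linarith [f.mono (hsab hx).1.le, f.mono (hsab hy).2]
    rintro _ ⟨x, hx, rfl⟩ _ ⟨y, hy, rfl⟩
    rcases le_total x y with h | h
    · exact key x hx y hy h
    · rw [edist_comm]; exact key y hy x hx h
  rw [← hmeas, StieltjesFunction.measure]
  exact houter s

lemma eventually_floor_injOn (T : Finset ℝ) :
    ∀ᶠ n : ℕ in atTop, InjOn (fun x : ℝ => ⌊(n : ℝ) * x⌋) T := by
  have h : ∀ p ∈ T ×ˢ T, ∀ᶠ n : ℕ in atTop,
      ⌊(n : ℝ) * p.1⌋ = ⌊(n : ℝ) * p.2⌋ → p.1 = p.2 := by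
    intro p _
    by_cases hp : p.1 = p.2
    · exact Eventually.of_forall fun _ _ => hp
    have hpos : 0 < |p.1 - p.2| := abs_pos.2 (sub_ne_zero.2 hp)
    filter_upwards [eventually_ge_atTop ⌈|p.1 - p.2|⁻¹⌉₊] with n hn heq
    exfalso
    have h1 := Int.abs_sub_lt_one_of_floor_eq_floor heq
    rw [← mul_sub, abs_mul, Nat.abs_cast] at h1
    have h2 : |p.1 - p.2|⁻¹ ≤ n := (Nat.le_ceil _).trans (by exact_mod_cast hn)
    have h3 : 1 ≤ n * |p.1 - p.2| := by
      rw [← inv_mul_cancel₀ hpos.ne']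
      gcongr
    linarith
  rw [← Filter.eventually_all_finset] at h
  filter_upwards [h] with n hn x hx y hy hxy
  exact hn (x, y) (Finset.mem_product.2 ⟨hx, hy⟩) hxy

/-- A one-sided coarea inequality: the sums of `g` over the fibres of `U` have a measurable
majorant of integral at most `∫ g dν`, provided `ν` dominates the size of images under `U`. -/
lemma exists_measurable_count_fiber_le {U : ℝ → ℝ} {ν : Measure ℝ}
    (hν : ∀ s, MeasurableSet s → volume (U '' s) ≤ ν s) {g : ℝ → ℝ≥0∞} (hg : Measurable g) :
    ∃ G : ℝ → ℝ≥0∞, Measurable G ∧ (∀ t, ∫⁻ x in U ⁻¹' {t}, g x ∂Measure.count ≤ G t) ∧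
      ∫⁻ t, G t ≤ ∫⁻ x, g x ∂ν := by
  refine Measurable.ennreal_induction (motive := fun g => ∃ G : ℝ → ℝ≥0∞, Measurable G ∧
    (∀ t, ∫⁻ x in U ⁻¹' {t}, g x ∂Measure.count ≤ G t) ∧ ∫⁻ t, G t ≤ ∫⁻ x, g x ∂ν) ?_ ?_ ?_ hg
  · intro c E hE
    let J : ℕ → ℤ → Set ℝ := fun n k => E ∩ {x | ⌊(n : ℝ) * x⌋ = k}
    have hJ : ∀ n k, MeasurableSet (J n k) := fun n k =>
      hE.inter ((Int.measurable_floor.comp (measurable_const_mul (n : ℝ)))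
        (measurableSet_singleton k))
    let G : ℕ → ℝ → ℝ≥0∞ := fun n t =>
      ∑' k, (toMeasurable volume (U '' J n k)).indicator (fun _ => (1 : ℝ≥0∞)) t
    have hG : ∀ n, Measurable (G n) := fun n => Measurable.tsum fun k =>
      measurable_const.indicator (measurableSet_toMeasurable _ _)
    have hGint : ∀ n, ∫⁻ t, G n t ≤ ν E := by
      intro n
      rw [lintegral_tsum fun k =>
        (measurable_const.indicator (measurableSet_toMeasurable _ _)).aemeasurable]
      have hdisj : Pairwise (Function.onFun Disjoint (J n)) := by
        intro k l hkl
        refine Set.disjoint_left.2 fun x hx hx' => hkl ?_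
        exact hx.2.symm.trans hx'.2
      calc ∑' k, ∫⁻ t, (toMeasurable volume (U '' J n k)).indicator (fun _ => (1 : ℝ≥0∞)) t
          ≤ ∑' k, ν (J n k) := by
            refine ENNReal.tsum_le_tsum fun k => ?_
            rw [lintegral_indicator (measurableSet_toMeasurable _ _), setLIntegral_one,
              measure_toMeasurable]
            exact hν _ (hJ n k)
        _ = ν (⋃ k, J n k) := (measure_iUnion hdisj (hJ n)).symm
        _ ≤ ν E := measure_mono (iUnion_subset fun k => inter_subset_left)
    have hfin : ∀ t (T : Finset ℝ), (T : Set ℝ) ⊆ E ∩ U ⁻¹' {t} →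
        (T.card : ℝ≥0∞) ≤ liminf (fun n => G n t) atTop := by
      intro t T hT
      refine le_liminf_of_le (by isBoundedDefault) ?_
      filter_upwards [eventually_floor_injOn T] with n hn
      calc (T.card : ℝ≥0∞) = ∑ k ∈ T.image (fun x : ℝ => ⌊(n : ℝ) * x⌋), 1 := by
            rw [Finset.sum_const, Finset.card_image_of_injOn hn]; simp
        _ ≤ ∑ k ∈ T.image (fun x : ℝ => ⌊(n : ℝ) * x⌋),
            (toMeasurable volume (U '' J n k)).indicator (fun _ => (1 : ℝ≥0∞)) t := by
            refine Finset.sum_le_sum fun k hk => ?_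
            obtain ⟨x, hx, rfl⟩ := Finset.mem_image.1 hk
            have hx' := hT hx
            rw [indicator_of_mem]
            exact subset_toMeasurable _ _ ⟨x, ⟨hx'.1, rfl⟩, hx'.2⟩
        _ ≤ G n t := ENNReal.sum_le_tsum _
    have hcount : ∀ t, Measure.count (E ∩ U ⁻¹' {t}) ≤ liminf (fun n => G n t) atTop := by
      intro t
      by_cases hf : (E ∩ U ⁻¹' {t}).Finite
      · rw [Measure.count_apply_finite _ hf]
        exact hfin t _ (by simp)
      · refine le_trans le_top (le_of_tendsto' ENNReal.tendsto_nat_nhds_top fun N => ?_)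
        obtain ⟨T, hT, rfl⟩ := Set.Infinite.exists_subset_card_eq hf N
        exact hfin t T hT
    have hLim : Measurable fun t => liminf (fun n => G n t) atTop := Measurable.liminf hG
    refine ⟨fun t => c * liminf (fun n => G n t) atTop, hLim.const_mul c, fun t => ?_, ?_⟩
    · rw [lintegral_indicator hE, Measure.restrict_restrict hE, setLIntegral_const]
      beta_reduce
      gcongr
      exact hcount t
    · rw [lintegral_indicator hE, setLIntegral_const, lintegral_const_mul _ hLim]
      gcongr
      refine (lintegral_liminf_le hG).trans (liminf_le_of_le (by isBoundedDefault) fun b hb => ?_)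
      obtain ⟨n, hn⟩ := hb.exists
      exact hn.trans (hGint n)
  · intro f g _ hf hg ihf ihg
    obtain ⟨F, hF, hF1, hF2⟩ := ihf
    obtain ⟨G, hG, hG1, hG2⟩ := ihg
    refine ⟨fun t => F t + G t, hF.add hG, fun t => ?_, ?_⟩
    · simp only [Pi.add_apply]
      rw [lintegral_add_left hf]
      exact add_le_add (hF1 t) (hG1 t)
    · simp only [Pi.add_apply]
      rw [lintegral_add_left hf, lintegral_add_left hF]
      exact add_le_add hF2 hG2
  · intro f hf hmono ih
    choose G hG hG1 hG2 using ih
    refine ⟨fun t => liminf (fun n => G n t) atTop, Measurable.liminf hG, fun t => ?_, ?_⟩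
    · rw [lintegral_iSup hf hmono]
      refine iSup_le fun n => le_liminf_of_le (by isBoundedDefault) ?_
      filter_upwards [eventually_ge_atTop n] with m hm
      exact (lintegral_mono (hmono hm)).trans (hG1 m t)
    · rw [lintegral_iSup hf hmono]
      refine (lintegral_liminf_le hG).trans (liminf_le_of_le (by isBoundedDefault) fun b hb => ?_)
      obtain ⟨n, hn⟩ := hb.exists
      exact (hn.trans (hG2 n)).trans (le_iSup (fun n => ∫⁻ x, f n x ∂ν) n)

/-- The right derivative of a convex function, as an infimum of difference quotients. -/
def rightSlope (f : ℝ → ℝ) (p : ℝ) : ℝ :=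
  ⨅ n : ℕ, ((n : ℝ) + 1) * (f (p + 1 / ((n : ℝ) + 1)) - f p)

lemma rightSlope_term_nonneg {f : ℝ → ℝ} (hm : MonotoneOn f (Ici 0)) {p : ℝ} (hp : 0 ≤ p) (n : ℕ) :
    0 ≤ ((n : ℝ) + 1) * (f (p + 1 / ((n : ℝ) + 1)) - f p) := by
  have h1 : (0 : ℝ) < 1 / ((n : ℝ) + 1) := by positivity
  have h2 := hm (mem_Ici.2 hp) (mem_Ici.2 (by linarith : 0 ≤ p + 1 / ((n : ℝ) + 1))) (by linarith)
  exact mul_nonneg (by positivity) (by linarith)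

lemma rightSlope_nonneg {f : ℝ → ℝ} (hm : MonotoneOn f (Ici 0)) {p : ℝ} (hp : 0 ≤ p) :
    0 ≤ rightSlope f p := le_ciInf fun n => rightSlope_term_nonneg hm hp n

lemma add_rightSlope_mul_le {f : ℝ → ℝ} (hf : ConvexOn ℝ (Ici 0) f) (hm : MonotoneOn f (Ici 0))
    {p q : ℝ} (hp : 0 ≤ p) (hq : 0 ≤ q) : f p + rightSlope f p * (q - p) ≤ f q := by
  have hterm : ∀ n : ℕ, ((n : ℝ) + 1) * (f (p + 1 / ((n : ℝ) + 1)) - f p)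
      = (f (p + 1 / ((n : ℝ) + 1)) - f p) / (p + 1 / ((n : ℝ) + 1) - p) := by
    intro n
    rw [add_sub_cancel_left, one_div, div_inv_eq_mul, mul_comm]
  have hpos : ∀ n : ℕ, (0 : ℝ) < 1 / ((n : ℝ) + 1) := fun n => by positivity
  rcases lt_trichotomy q p with h | rfl | h
  · have h1 : (f q - f p) / (q - p) ≤ rightSlope f p := by
      refine le_ciInf fun n => ?_
      rw [hterm]
      have := hpos n
      exact hf.secant_mono hp hq (mem_Ici.2 (by linarith)) h.ne (by linarith) (by linarith)
    rw [div_le_iff_of_neg (by linarith)] at h1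
    linarith
  · simp
  · obtain ⟨n, hn⟩ := exists_nat_one_div_lt (sub_pos.2 h)
    have h1 : rightSlope f p ≤ (f q - f p) / (q - p) := by
      refine (ciInf_le ⟨0, ?_⟩ n).trans ?_
      · rintro _ ⟨n, rfl⟩
        exact rightSlope_term_nonneg hm hp n
      · rw [hterm]
        have := hpos n
        exact hf.secant_mono hp (mem_Ici.2 (by linarith)) hq (by linarith) h.ne' (by linarith)
    rw [le_div_iff₀ (by linarith)] at h1
    linarith

/-- The left endpoint `1 - |A_t|` of the rearranged superlevel set of `u` at height `t`. -/
def levelPoint (u : ℝ → ℝ) (t : ℝ) : ℝ :=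
  1 - (volume {y ∈ Icc (-1 : ℝ) 1 | u y > t}).toReal

lemma volume_superlevel_le (u : ℝ → ℝ) (t : ℝ) :
    volume {y ∈ Icc (-1 : ℝ) 1 | u y > t} ≤ 2 := by
  refine (measure_mono (sep_subset _ _)).trans ?_
  rw [Real.volume_Icc]
  norm_num

lemma volume_superlevel_ne_top (u : ℝ → ℝ) (t : ℝ) :
    volume {y ∈ Icc (-1 : ℝ) 1 | u y > t} ≠ ∞ :=
  ((volume_superlevel_le u t).trans_lt (by simp)).ne

lemma levelPoint_mono (u : ℝ → ℝ) : Monotone (levelPoint u) := fun s _ hst =>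
  sub_le_sub_left (ENNReal.toReal_mono (volume_superlevel_ne_top u s)
    (measure_mono fun _ hy => ⟨hy.1, lt_of_le_of_lt hst hy.2⟩)) 1

lemma levelPoint_le_one (u : ℝ → ℝ) (t : ℝ) : levelPoint u t ≤ 1 :=
  sub_le_self 1 ENNReal.toReal_nonneg

lemma neg_one_le_levelPoint (u : ℝ → ℝ) (t : ℝ) : -1 ≤ levelPoint u t := by
  have := ENNReal.toReal_mono (by simp) (volume_superlevel_le u t)
  rw [levelPoint]
  norm_num at this ⊢
  linarith

lemma exists_gt_levelPoint_lt {u : ℝ → ℝ} {s x : ℝ} (h : levelPoint u s < x) :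
    ∃ t, s < t ∧ levelPoint u t < x := by
  let A : ℕ → Set ℝ := fun n => {y ∈ Icc (-1 : ℝ) 1 | u y > s + 1 / ((n : ℝ) + 1)}
  have hA : Monotone A := by
    intro n k hnk y hy
    refine ⟨hy.1, lt_of_le_of_lt ?_ hy.2⟩
    gcongr
  have hU : ⋃ n, A n = {y ∈ Icc (-1 : ℝ) 1 | u y > s} := by
    ext y
    simp only [A, mem_iUnion, mem_ofPred_eq]
    constructor
    · rintro ⟨n, h1, h2⟩
      have : (0 : ℝ) < 1 / ((n : ℝ) + 1) := by positivity
      exact ⟨h1, by linarith⟩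
    · rintro ⟨h1, h2⟩
      obtain ⟨n, hn⟩ := exists_nat_one_div_lt (sub_pos.2 h2)
      exact ⟨n, h1, by linarith⟩
  have hlim := tendsto_measure_iUnion_atTop (μ := volume) hA
  rw [hU] at hlim
  have hlim' := (ENNReal.tendsto_toReal (volume_superlevel_ne_top u s)).comp hlim
  have hlt : 1 - x < (volume {y ∈ Icc (-1 : ℝ) 1 | u y > s}).toReal := by
    rw [levelPoint] at h; linarith
  obtain ⟨n, hn⟩ := (hlim'.eventually_const_lt hlt).exists
  refine ⟨s + 1 / ((n : ℝ) + 1), by have : (0 : ℝ) < 1 / ((n : ℝ) + 1) := by positivity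
                                    linarith, ?_⟩
  simp only [Function.comp, A] at hn
  rw [levelPoint]
  linarith

lemma mrear_eq_volume (u : ℝ → ℝ) {x : ℝ} (hx : x ≤ 1) :
    mrear u x = volume.real {t | 0 < t ∧ levelPoint u t ≤ x} := by
  have hmeas : MeasurableSet {t | levelPoint u t ≤ x} :=
    measurableSet_le (levelPoint_mono u).measurable measurable_const
  have : ∀ t, (Icc (1 - (volume {y ∈ Icc (-1 : ℝ) 1 | u y > t}).toReal) 1).indicator
      (fun _ => (1 : ℝ)) x = {t | levelPoint u t ≤ x}.indicator (fun _ => (1 : ℝ)) t := by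
    intro t
    simp [indicator_apply, levelPoint, hx]
  simp_rw [mrear, this]
  rw [integral_indicator hmeas, Measure.restrict_restrict hmeas]
  simp only [integral_const, smul_eq_mul, mul_one, measureReal_restrict_apply_univ]
  congr 1
  ext t
  simp [and_comm]

lemma mrear_nonneg (u : ℝ → ℝ) (x : ℝ) : 0 ≤ mrear u x :=
  integral_nonneg fun _ => indicator_nonneg (fun _ _ => zero_le_one) _

lemma mrear_le {u : ℝ → ℝ} {s x : ℝ} (hs : 0 ≤ s) (hx : x ≤ 1) (h : x < levelPoint u s) :
    mrear u x ≤ s := by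
  rw [mrear_eq_volume u hx]
  calc volume.real {t | 0 < t ∧ levelPoint u t ≤ x} ≤ volume.real (Ioc 0 s) := by
        refine measureReal_mono (fun t ht => ⟨ht.1, ?_⟩) (by simp)
        by_contra hts
        linarith [levelPoint_mono u (not_le.1 hts).le, ht.2]
    _ = s := by rw [Real.volume_real_Ioc_of_le hs, sub_zero]

lemma levelPoint_eq_one {u : ℝ → ℝ} {M : ℝ} (hM : ∀ x ∈ Icc (-1 : ℝ) 1, u x ≤ M) :
    levelPoint u M = 1 := by
  have : {y ∈ Icc (-1 : ℝ) 1 | u y > M} = ∅ := by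
    ext y
    simp only [mem_ofPred_eq, mem_empty_iff_false, iff_false, not_and, not_lt]
    exact hM y
  rw [levelPoint, this]
  simp

lemma lt_mrear {u : ℝ → ℝ} {M : ℝ} (hM : ∀ x ∈ Icc (-1 : ℝ) 1, u x ≤ M) {s x : ℝ} (hs : 0 ≤ s)
    (hx : x < 1) (h : levelPoint u s < x) : s < mrear u x := by
  obtain ⟨t, hst, ht⟩ := exists_gt_levelPoint_lt h
  refine hst.trans_le ?_
  rw [mrear_eq_volume u hx.le]
  calc t = volume.real (Ioc 0 t) := by rw [Real.volume_real_Ioc_of_le (by linarith), sub_zero]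
    _ ≤ volume.real {t | 0 < t ∧ levelPoint u t ≤ x} := by
      refine measureReal_mono (fun r hr => ⟨hr.1, (levelPoint_mono u hr.2).trans ht.le⟩) ?_
      refine ne_top_of_le_ne_top (measure_Ioc_lt_top (μ := volume) (a := 0) (b := M)).ne
        (measure_mono fun r hr => ⟨hr.1, ?_⟩)
      by_contra hrM
      have h1 := levelPoint_mono u (not_le.1 hrM).le
      rw [levelPoint_eq_one hM] at h1
      linarith [hr.2]

lemma mrear_monotoneOn {u : ℝ → ℝ} {M : ℝ} (hM : ∀ x ∈ Icc (-1 : ℝ) 1, u x ≤ M) :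
    MonotoneOn (mrear u) (Iio 1) := by
  intro x hx x' hx' hxx'
  rcases hxx'.eq_or_lt with rfl | hlt
  · exact le_rfl
  by_contra hcon
  push Not at hcon
  have h0 := mrear_nonneg u x'
  have h1 : levelPoint u (mrear u x') ≤ x := by
    by_contra h
    linarith [mrear_le h0 (le_of_lt hx) (not_le.1 h)]
  have h2 : x' ≤ levelPoint u (mrear u x') := by
    by_contra h
    linarith [lt_mrear hM h0 hx' (not_le.1 h)]
  linarith

lemma aemeasurable_mrear {u : ℝ → ℝ} {M : ℝ} (hM : ∀ x ∈ Icc (-1 : ℝ) 1, u x ≤ M) :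
    AEMeasurable (mrear u) (volume.restrict (Icc (-1 : ℝ) 1)) := by
  rw [← Measure.restrict_congr_set (Ico_ae_eq_Icc (μ := volume) (a := (-1 : ℝ)) (b := 1))]
  exact aemeasurable_restrict_of_monotoneOn measurableSet_Ico
    ((mrear_monotoneOn hM).mono fun x hx => hx.2)

/-- `u` and its monotone rearrangement are equimeasurable. -/
lemma lintegral_comp_mrear {u : ℝ → ℝ} {M : ℝ} (hM : ∀ x ∈ Icc (-1 : ℝ) 1, u x ≤ M)
    (hc : ContinuousOn u (Icc (-1 : ℝ) 1)) (hnn : ∀ x ∈ Icc (-1 : ℝ) 1, 0 ≤ u x)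
    {φ : ℝ → ℝ≥0∞} (hφ : Measurable φ) :
    ∫⁻ x in Icc (-1 : ℝ) 1, φ (mrear u x) = ∫⁻ x in Icc (-1 : ℝ) 1, φ (u x) := by
  have hw := aemeasurable_mrear hM
  have hu : AEMeasurable u (volume.restrict (Icc (-1 : ℝ) 1)) := hc.aemeasurable measurableSet_Icc
  have hmap : Measure.map (mrear u) (volume.restrict (Icc (-1 : ℝ) 1))
      = Measure.map u (volume.restrict (Icc (-1 : ℝ) 1)) := by
    refine Measure.ext_of_Iic _ _ fun s => ?_
    rw [Measure.map_apply_of_aemeasurable hw measurableSet_Iic,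
      Measure.map_apply_of_aemeasurable hu measurableSet_Iic,
      Measure.restrict_apply' measurableSet_Icc, Measure.restrict_apply' measurableSet_Icc]
    rcases lt_or_ge s 0 with hs | hs
    · congr 1
      ext x
      simp only [mem_inter_iff, mem_preimage, mem_Iic]
      refine ⟨fun ⟨h1, _⟩ => absurd h1 (by linarith [mrear_nonneg u x]),
        fun ⟨h1, h2⟩ => absurd h1 (by linarith [hnn x h2])⟩
    · have h1 : volume (mrear u ⁻¹' Iic s ∩ Icc (-1) 1) = volume (Icc (-1) (levelPoint u s)) := by
        refine measure_congr ?_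
        filter_upwards [compl_mem_ae_iff.2 (measure_singleton (μ := volume) (levelPoint u s)),
          compl_mem_ae_iff.2 (measure_singleton (μ := volume) (1 : ℝ))] with x hx1 hx2
        apply propext
        change x ∈ mrear u ⁻¹' Iic s ∩ Icc (-1) 1 ↔ x ∈ Icc (-1) (levelPoint u s)
        simp only [mem_compl_iff, mem_singleton_iff] at hx1 hx2
        simp only [mem_inter_iff, mem_preimage, mem_Iic, mem_Icc]
        constructor
        · rintro ⟨h1, h2, h3⟩
          refine ⟨h2, ?_⟩
          by_contra h
          linarith [lt_mrear hM hs (lt_of_le_of_ne h3 hx2) (not_le.1 h)]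
        · rintro ⟨h1, h2⟩
          have h3 := h2.trans (levelPoint_le_one u s)
          exact ⟨mrear_le hs h3 (lt_of_le_of_ne h2 hx1), h1, h3⟩
      have h2 : u ⁻¹' Iic s ∩ Icc (-1) 1
          = Icc (-1 : ℝ) 1 \ {y ∈ Icc (-1 : ℝ) 1 | u y > s} := by
        ext x
        simp only [Set.mem_sdiff, mem_inter_iff, mem_preimage, mem_Iic, mem_ofPred_eq, not_and,
          not_lt]
        exact ⟨fun h => ⟨h.2, fun _ => h.1⟩, fun h => ⟨h.2 h.1, h.1⟩⟩
      have h3 : NullMeasurableSet {y ∈ Icc (-1 : ℝ) 1 | u y > s} := by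
        have h4 : {y ∈ Icc (-1 : ℝ) 1 | u y > s} = Icc (-1) 1 \ (Icc (-1) 1 ∩ u ⁻¹' Iic s) := by
          ext x
          simp only [Set.mem_sdiff, mem_inter_iff, mem_preimage, mem_Iic, mem_ofPred_eq, not_and,
            not_le]
          exact ⟨fun h => ⟨h.1, fun _ => h.2⟩, fun h => ⟨h.1, h.2 h.1⟩⟩
        rw [h4]
        exact (measurableSet_Icc.diff (hc.preimage_isClosed_of_isClosed isClosed_Icc
          isClosed_Iic).measurableSet).nullMeasurableSet
      rw [h1, h2, measure_sdiff (sep_subset _ _) h3 (volume_superlevel_ne_top u s),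
        Real.volume_Icc, Real.volume_Icc, levelPoint,
        ← ENNReal.ofReal_toReal (volume_superlevel_ne_top u s), ← ENNReal.ofReal_sub _
        ENNReal.toReal_nonneg, ENNReal.toReal_ofReal ENNReal.toReal_nonneg]
      congr 1
      ring
  rw [← lintegral_map' hφ.aemeasurable hw, hmap, lintegral_map' hφ.aemeasurable hu]

lemma le_levelPoint_mrear {u : ℝ → ℝ} {M : ℝ} (hM : ∀ x ∈ Icc (-1 : ℝ) 1, u x ≤ M) {x : ℝ}
    (hx : x < 1) : x ≤ levelPoint u (mrear u x) := by
  by_contra h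
  exact lt_irrefl _ (lt_mrear hM (mrear_nonneg u x) hx (not_le.1 h))

lemma mrear_eq_of_lt_levelPoint {u : ℝ → ℝ} {M : ℝ} (hM : ∀ x ∈ Icc (-1 : ℝ) 1, u x ≤ M)
    {x z : ℝ} (hxz : x ≤ z) (hz : z < levelPoint u (mrear u x)) : mrear u z = mrear u x := by
  have hz1 : z < 1 := hz.trans_le (levelPoint_le_one u _)
  exact le_antisymm (mrear_le (mrear_nonneg u x) hz1.le hz)
    (mrear_monotoneOn hM (hxz.trans_lt hz1) hz1 hxz)

lemma deriv_mrear_eq_zero {u : ℝ → ℝ} {M : ℝ} (hM : ∀ x ∈ Icc (-1 : ℝ) 1, u x ≤ M) {x : ℝ}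
    (hx : x < levelPoint u (mrear u x)) : deriv (mrear u) x = 0 := by
  by_cases hd : DifferentiableAt ℝ (mrear u) x
  · have h1 : mrear u =ᶠ[nhdsWithin x (Ici x)] fun _ => mrear u x := by
      filter_upwards [Ico_mem_nhdsGE hx] with z hz
      exact mrear_eq_of_lt_levelPoint hM hz.1 hz.2
    have h2 := (hasDerivWithinAt_const x (Ici x) (mrear u x)).congr_of_eventuallyEq h1 rfl
    exact (uniqueDiffWithinAt_Ici x).eq_deriv _ hd.hasDerivAt.hasDerivWithinAt h2
  · exact deriv_zero_of_not_differentiableAt hd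

lemma deriv_mrear_levelPoint_eq_zero {u : ℝ → ℝ} {M : ℝ} (hM : ∀ x ∈ Icc (-1 : ℝ) 1, u x ≤ M)
    {x : ℝ} (hx : x < levelPoint u (mrear u x)) :
    deriv (mrear u) (levelPoint u (mrear u x)) = 0 := by
  set y := levelPoint u (mrear u x) with hy
  by_cases hd : DifferentiableAt ℝ (mrear u) y
  · have h1 : mrear u =ᶠ[nhdsWithin y (Iio y)] fun _ => mrear u x := by
      filter_upwards [Ico_mem_nhdsLT hx] with z hz
      exact mrear_eq_of_lt_levelPoint hM hz.1 hz.2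
    have h3 : mrear u y = mrear u x :=
      tendsto_nhds_unique (hd.continuousAt.tendsto.mono_left nhdsWithin_le_nhds)
        (tendsto_const_nhds.congr' h1.symm)
    have h2 := (hasDerivWithinAt_const y (Iio y) (mrear u x)).congr_of_eventuallyEq h1 h3
    exact (uniqueDiffWithinAt_Iio y).eq_deriv _ hd.hasDerivAt.hasDerivWithinAt h2
  · exact deriv_zero_of_not_differentiableAt hd

/-- The slope `|(u*)'|` of the monotone rearrangement as a function of the height. -/
def levelSlope (u : ℝ → ℝ) (t : ℝ) : ℝ :=
  (Ioo (-1 : ℝ) 1).indicator (fun z => |deriv (mrear u) z|) (levelPoint u t)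

lemma measurable_levelSlope (u : ℝ → ℝ) : Measurable (levelSlope u) :=
  ((continuous_abs.measurable.comp (measurable_deriv (mrear u))).indicator measurableSet_Ioo).comp
    (levelPoint_mono u).measurable

lemma levelSlope_nonneg (u : ℝ → ℝ) (t : ℝ) : 0 ≤ levelSlope u t :=
  indicator_nonneg (fun _ _ => abs_nonneg _) _

lemma levelPoint_mrear_eq {u : ℝ → ℝ} {M : ℝ} (hM : ∀ x ∈ Icc (-1 : ℝ) 1, u x ≤ M) {x : ℝ}
    (hx : x < 1) (hd : deriv (mrear u) x ≠ 0) : levelPoint u (mrear u x) = x :=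
  ((le_levelPoint_mrear hM hx).antisymm
    (not_lt.1 fun h => hd (deriv_mrear_eq_zero hM h))).symm

lemma mul_levelSlope_mrear {u : ℝ → ℝ} {M : ℝ} (hM : ∀ x ∈ Icc (-1 : ℝ) 1, u x ≤ M) {x : ℝ}
    (hx : x ∈ Ioo (-1 : ℝ) 1) (b : ℝ → ℝ) :
    b (levelPoint u (mrear u x)) * levelSlope u (mrear u x) = b x * |deriv (mrear u) x| := by
  rcases (le_levelPoint_mrear hM hx.2).eq_or_lt with h | h
  · rw [levelSlope, ← h, indicator_of_mem hx]
  · rw [levelSlope, deriv_mrear_eq_zero hM h]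
    simp [indicator_apply, deriv_mrear_levelPoint_eq_zero hM h]

/-- The projection of the real line onto `[-1,1]`. -/
def clamp (x : ℝ) : ℝ := max (-1) (min x 1)

lemma continuous_clamp : Continuous clamp := by unfold clamp; fun_prop

lemma clamp_mem (x : ℝ) : clamp x ∈ Icc (-1 : ℝ) 1 :=
  ⟨le_max_left _ _, max_le (by norm_num) (min_le_right _ _)⟩

lemma clamp_of_mem {x : ℝ} (hx : x ∈ Icc (-1 : ℝ) 1) : clamp x = x := by
  rw [clamp, min_eq_left hx.2, max_eq_right hx.1]

lemma clamp_mono : Monotone clamp := fun _ _ h => max_le_max_left _ (min_le_min_right _ h)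

lemma Ioc_clamp_subset (x y : ℝ) : Ioc (clamp x) (clamp y) ⊆ Ioc x y ∩ Icc (-1) 1 := by
  rintro z ⟨h1, h2⟩
  have h3 := (clamp_mem x).1
  have h4 := (clamp_mem y).2
  refine ⟨⟨?_, ?_⟩, by linarith, by linarith⟩
  · by_contra h
    have : z ≤ clamp x := le_max_of_le_right (le_min (not_lt.1 h) (by linarith))
    linarith
  · rcases le_max_iff.1 h2 with h | h
    · linarith
    · exact h.trans (min_le_left _ _)

namespace MemW11

variable {u : ℝ → ℝ}

lemma integrableOn_abs (hu : MemW11 u) :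
    IntegrableOn (fun z => |deriv u z|) (Icc (-1) 1) := hu.1.abs

lemma intervalIntegrable (hu : MemW11 u) {x y : ℝ} (hx : x ∈ Icc (-1 : ℝ) 1)
    (hy : y ∈ Icc (-1 : ℝ) 1) : IntervalIntegrable (deriv u) volume x y :=
  (hu.1.mono_set ((uIcc_subset_Icc hx hy))).intervalIntegrable

lemma sub_eq (hu : MemW11 u) {x y : ℝ} (hx : x ∈ Icc (-1 : ℝ) 1) (hy : y ∈ Icc (-1 : ℝ) 1) :
    u y - u x = ∫ t in x..y, deriv u t := by
  have h1 : (-1 : ℝ) ∈ Icc (-1 : ℝ) 1 := by norm_num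
  have := intervalIntegral.integral_add_adjacent_intervals (hu.intervalIntegrable h1 hx)
    (hu.intervalIntegrable hx hy)
  rw [hu.2 x hx, hu.2 y hy]
  linarith

lemma continuousOn (hu : MemW11 u) : ContinuousOn u (Icc (-1) 1) := by
  have h := intervalIntegral.continuousOn_primitive_interval (μ := volume) (f := deriv u)
    (a := -1) (b := 1) (by rw [uIcc_of_le (by norm_num)]; exact hu.1)
  rw [uIcc_of_le (by norm_num)] at h
  exact (continuousOn_const.add h).congr hu.2

lemma continuous_comp_clamp (hu : MemW11 u) : Continuous fun x => u (clamp x) :=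
  hu.continuousOn.comp_continuous continuous_clamp clamp_mem

lemma abs_sub_le (hu : MemW11 u) {x y : ℝ} (hxy : x ≤ y) :
    |u (clamp y) - u (clamp x)| ≤
      ∫ t in x..y, (Icc (-1 : ℝ) 1).indicator (fun z => |deriv u z|) t := by
  have hle := clamp_mono hxy
  rw [hu.sub_eq (clamp_mem x) (clamp_mem y), intervalIntegral.integral_of_le hxy,
    setIntegral_indicator measurableSet_Icc]
  refine (intervalIntegral.abs_integral_le_integral_abs hle).trans ?_
  rw [intervalIntegral.integral_of_le hle]
  refine setIntegral_mono_set (hu.integrableOn_abs.mono_set inter_subset_right)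
    (Eventually.of_forall fun _ => abs_nonneg _) (Ioc_clamp_subset x y).eventuallyLE

lemma volume_image_le (hu : MemW11 u) (s : Set ℝ) :
    volume ((fun x => u (clamp x)) '' s) ≤ volume.withDensity (fun x =>
      ENNReal.ofReal ((Icc (-1 : ℝ) 1).indicator (fun z => |deriv u z|) x)) s :=
  volume_image_le_withDensity (hu.integrableOn_abs.integrable_indicator measurableSet_Icc)
    (fun _ => indicator_nonneg (fun _ _ => abs_nonneg _) _) (fun _ _ => hu.abs_sub_le) s

end MemW11

lemma Weight.continuous_comp_clamp {a : ℝ → ℝ → ℝ} (ha : Weight a) :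
    Continuous fun p : ℝ × ℝ => a (clamp p.1) (max p.2 0) :=
  ha.1.comp_continuous (f := fun p : ℝ × ℝ => (clamp p.1, max p.2 0))
    ((continuous_clamp.comp continuous_fst).prodMk (continuous_snd.max continuous_const))
    fun p => ⟨clamp_mem p.1, mem_Ici.2 (le_max_right p.2 0)⟩

/-- Condition (C) bounds the weight at the rearranged point by the weights along the level set. -/
lemma ofReal_weight_levelPoint_le {a : ℝ → ℝ → ℝ} (ha : Weight a) (hC : CondC a) {u : ℝ → ℝ}
    (hu : MemW11 u) (hpin : u (-1) = 0) {t : ℝ} (ht : 0 < t) (hy : levelPoint u t < 1)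
    (K : Finset ℝ) (hK : ∀ x, x ∈ K ↔ x ∈ Icc (-1 : ℝ) 1 ∧ u (clamp x) = t) :
    ENNReal.ofReal (a (levelPoint u t) t) ≤ ∑ x ∈ K, ENNReal.ofReal (a x t) := by
  have hset : Icc (-1) 1 ∩ {x | 0 < u (clamp x) - t} = {y ∈ Icc (-1 : ℝ) 1 | u y > t} := by
    ext x
    simp only [mem_inter_iff, mem_ofPred_eq, sub_pos]
    refine and_congr_right fun hx => ?_
    rw [clamp_of_mem hx]
  have hvol : 1 - volume.real (Icc (-1) 1 ∩ {x | 0 < u (clamp x) - t}) = levelPoint u t := by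
    rw [hset, levelPoint, Measure.real]
  have h1 : (-1 : ℝ) ∈ Icc (-1 : ℝ) 1 := by norm_num
  have h := condC1_le_sum_zeros (b := fun x => a x t) (fun x hx => ha.2 x t hx ht.le)
    (fun x y hx hxy hy => hC x y t hx hxy hy ht.le) K (fun x hx => ((hK x).1 hx).1) K.card
    (fun x => u (clamp x) - t) (hu.continuous_comp_clamp.sub continuous_const)
    (fun x hx => by rw [hK, sub_eq_zero]; exact ⟨fun h => ⟨hx, h⟩, fun h => h.2⟩) (-1) h1
    (Finset.card_filter_le _ _) (by simp only [clamp_of_mem h1, hpin]; linarith)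
    (by linarith)
  rw [hvol] at h
  have hnn : ∀ x ∈ K, 0 ≤ a x t := fun x hx => ha.2 x t ((hK x).1 hx).1 ht.le
  rw [← ENNReal.ofReal_sum_of_nonneg hnn]
  exact ENNReal.ofReal_le_ofReal (h.trans (Finset.sum_le_sum_of_subset_of_nonneg
    (Finset.filter_subset _ _) fun x hx _ => hnn x hx))

/-- The rearrangement inequality for integrands that are linear in the derivative. -/
lemma lintegral_weight_deriv_mrear_le {a : ℝ → ℝ → ℝ} (ha : Weight a) (hC : CondC a) {u : ℝ → ℝ}
    (hu : MemW11 u) (hpin : u (-1) = 0) {M : ℝ} (hM : ∀ x ∈ Icc (-1 : ℝ) 1, u x ≤ M)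
    (hnn : ∀ x ∈ Icc (-1 : ℝ) 1, 0 ≤ u x) {c : ℝ → ℝ≥0∞} (hc : Measurable c) :
    ∫⁻ x in Icc (-1 : ℝ) 1,
        c (mrear u x) * ENNReal.ofReal (a x (mrear u x) * |deriv (mrear u) x|) ≤
      ∫⁻ x in Icc (-1 : ℝ) 1, c (u x) * ENNReal.ofReal (a x (u x) * |deriv u x|) := by
  set w := mrear u with hw
  set U : ℝ → ℝ := fun x => u (clamp x) with hU
  have hUm : Measurable U := hu.continuous_comp_clamp.measurable
  set A : ℝ → ℝ → ℝ := fun x v => a (clamp x) (max v 0) with hA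
  have hAm : Measurable fun p : ℝ × ℝ => A p.1 p.2 := ha.continuous_comp_clamp.measurable
  set d : ℝ → ℝ := (Icc (-1 : ℝ) 1).indicator (fun z => |deriv u z|) with hd
  have hdm : Measurable d :=
    (continuous_abs.measurable.comp (measurable_deriv u)).indicator measurableSet_Icc
  set ν := volume.withDensity (fun x => ENNReal.ofReal (d x)) with hν
  have hνU : ∀ s, MeasurableSet s → volume (U '' s) ≤ ν s := fun s _ => hu.volume_image_le s
  set g : ℝ → ℝ≥0∞ := (Icc (-1 : ℝ) 1).indicator
    (fun x => c (U x) * ENNReal.ofReal (A x (U x))) with hg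
  have hgm : Measurable g :=
    ((hc.comp hUm).mul (hAm.comp (measurable_id.prodMk hUm)).ennreal_ofReal).indicator
      measurableSet_Icc
  obtain ⟨G, hGm, hGle, hGint⟩ := exists_measurable_count_fiber_le hνU hgm
  obtain ⟨N, hNm, hNle, hNint⟩ := exists_measurable_count_fiber_le hνU
    (measurable_one.indicator (measurableSet_Icc (a := (-1 : ℝ)) (b := 1)) :
      Measurable ((Icc (-1 : ℝ) 1).indicator (1 : ℝ → ℝ≥0∞)))
  have hNfin : ∀ᵐ t, N t < ∞ := by
    refine ae_lt_top hNm (ne_top_of_le_ne_top ?_ hNint)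
    rw [lintegral_indicator_one measurableSet_Icc, hν, withDensity_apply _ measurableSet_Icc]
    have := (hu.integrableOn_abs.integrable_indicator measurableSet_Icc).lintegral_lt_top
    exact ((lintegral_mono' Measure.restrict_le_self le_rfl).trans_lt this).ne
  have hlevel : ∀ᵐ t, 0 ≤ t → levelPoint u t < 1 →
      c t * ENNReal.ofReal (A (levelPoint u t) t) ≤ G t := by
    filter_upwards [hNfin, compl_mem_ae_iff.2 (measure_singleton (μ := volume) (0 : ℝ))]
      with t hNt ht0 ht hy
    have htpos : 0 < t := lt_of_le_of_ne ht (Ne.symm ht0)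
    have hfib : (Icc (-1 : ℝ) 1 ∩ U ⁻¹' {t}).Finite := by
      rw [← Measure.count_apply_lt_top]
      have := (hNle t).trans_lt hNt
      rwa [lintegral_indicator_one measurableSet_Icc,
        Measure.restrict_apply measurableSet_Icc] at this
    have hK : ∀ x, x ∈ hfib.toFinset ↔ x ∈ Icc (-1 : ℝ) 1 ∧ u (clamp x) = t := by
      intro x
      simp [hU]
    have h1 := ofReal_weight_levelPoint_le ha hC hu hpin htpos hy hfib.toFinset hK
    calc c t * ENNReal.ofReal (A (levelPoint u t) t)
        ≤ c t * ∑ x ∈ hfib.toFinset, ENNReal.ofReal (a x t) := by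
          gcongr
          simp only [hA]
          rwa [max_eq_left ht, clamp_of_mem ⟨neg_one_le_levelPoint u t, hy.le⟩]
      _ = ∑ x ∈ hfib.toFinset, g x := by
          rw [Finset.mul_sum]
          refine Finset.sum_congr rfl fun x hx => ?_
          obtain ⟨hx1, hx2⟩ := (hK x).1 hx
          rw [hg, indicator_of_mem hx1]
          simp only [hU, hA, hx2]
          rw [max_eq_left ht, clamp_of_mem hx1]
      _ = ∫⁻ x in (hfib.toFinset : Set ℝ), g x ∂Measure.count := by
          rw [lintegral_finset]
          simp
      _ ≤ ∫⁻ x in U ⁻¹' {t}, g x ∂Measure.count :=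
          lintegral_mono_set fun x hx => ((hK x).1 hx).2
      _ ≤ G t := hGle t
  set S : Set ℝ := Ioo (-1 : ℝ) 1 ∩ {x | deriv w x ≠ 0} with hS
  have hSm : MeasurableSet S :=
    measurableSet_Ioo.inter ((measurable_deriv w) (measurableSet_singleton 0).compl)
  have hSd : ∀ x ∈ S, HasDerivWithinAt w (deriv w x) S x := fun x hx =>
    (differentiableAt_of_deriv_ne_zero hx.2).hasDerivAt.hasDerivWithinAt
  have hSy : ∀ x ∈ S, levelPoint u (w x) = x := fun x hx => levelPoint_mrear_eq hM hx.1.2 hx.2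
  have hSinj : InjOn w S := fun x hx x' hx' h => by rw [← hSy x hx, ← hSy x' hx', h]
  have hSim : MeasurableSet (w '' S) :=
    measurable_image_of_fderivWithin hSm (fun x hx => (hSd x hx).hasFDerivWithinAt) hSinj
  calc ∫⁻ x in Icc (-1 : ℝ) 1, c (w x) * ENNReal.ofReal (a x (w x) * |deriv w x|)
      = ∫⁻ x in S, c (w x) * ENNReal.ofReal (a x (w x) * |deriv w x|) := by
        rw [← Measure.restrict_congr_set (Ioo_ae_eq_Icc (μ := volume) (a := (-1 : ℝ)) (b := 1))]
        have hDm : MeasurableSet {x | deriv w x ≠ 0} :=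
          (measurable_deriv w) (measurableSet_singleton 0).compl
        rw [← lintegral_inter_add_sdiff _ _ hDm, setLIntegral_eq_zero (measurableSet_Ioo.diff hDm),
          add_zero]
        intro x hx
        have : deriv w x = 0 := not_not.1 hx.2
        simp [this]
    _ = ∫⁻ x in S, ENNReal.ofReal |deriv w x| *
          (c (w x) * ENNReal.ofReal (A (levelPoint u (w x)) (w x))) := by
        refine setLIntegral_congr_fun hSm fun x hx => ?_
        have hx' : x ∈ Icc (-1 : ℝ) 1 := Ioo_subset_Icc_self hx.1
        have h0 : 0 ≤ w x := mrear_nonneg u x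
        simp only [hA]
        rw [hSy x hx, clamp_of_mem hx', max_eq_left h0, ENNReal.ofReal_mul (ha.2 _ _ hx' h0)]
        ring
    _ = ∫⁻ t in w '' S, c t * ENNReal.ofReal (A (levelPoint u t) t) :=
        (lintegral_image_eq_lintegral_abs_deriv_mul hSm hSd hSinj
          fun t => c t * ENNReal.ofReal (A (levelPoint u t) t)).symm
    _ ≤ ∫⁻ t in w '' S, G t := by
        refine lintegral_mono_ae ((ae_restrict_iff' hSim).2 ?_)
        filter_upwards [hlevel] with t ht
        rintro ⟨x, hx, rfl⟩
        exact ht (mrear_nonneg u x) (by rw [hSy x hx]; exact hx.1.2)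
    _ ≤ ∫⁻ t, G t := setLIntegral_le_lintegral _ _
    _ ≤ ∫⁻ x, g x ∂ν := hGint
    _ = ∫⁻ x, (Icc (-1 : ℝ) 1).indicator
          (fun x => c (u x) * ENNReal.ofReal (a x (u x) * |deriv u x|)) x := by
        rw [hν, lintegral_withDensity_eq_lintegral_mul _ hdm.ennreal_ofReal hgm]
        refine lintegral_congr fun x => ?_
        by_cases hx : x ∈ Icc (-1 : ℝ) 1
        · simp only [Pi.mul_apply, hd, hg, indicator_of_mem hx, hU, hA]
          rw [clamp_of_mem hx, max_eq_left (hnn x hx), ENNReal.ofReal_mul (ha.2 _ _ hx (hnn x hx))]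
          ring
        · simp only [Pi.mul_apply, hd, hg, indicator_of_notMem hx, mul_zero]
    _ = ∫⁻ x in Icc (-1 : ℝ) 1, c (u x) * ENNReal.ofReal (a x (u x) * |deriv u x|) :=
        lintegral_indicator measurableSet_Icc _

namespace MemFrakF

variable {F : ℝ → ℝ → ℝ}

lemma measurable_comp (hF : MemFrakF F) {q : ℝ → ℝ} (hq : Measurable q) (hq0 : ∀ t, 0 ≤ q t) :
    Measurable fun t => F (max t 0) (q t) := by
  have h : Continuous fun p : ℝ × ℝ => F (max p.1 0) (max p.2 0) :=
    hF.1.comp_continuous (f := fun p : ℝ × ℝ => (max p.1 0, max p.2 0))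
      (by fun_prop) fun p => ⟨mem_Ici.2 (le_max_right p.1 0), mem_Ici.2 (le_max_right p.2 0)⟩
  have h2 := h.measurable.comp (measurable_id.prodMk hq)
  simpa [Function.comp_def, max_eq_left (hq0 _)] using h2

lemma measurable_rightSlope (hF : MemFrakF F) {q : ℝ → ℝ} (hq : Measurable q)
    (hq0 : ∀ t, 0 ≤ q t) : Measurable fun t => rightSlope (F (max t 0)) (q t) := by
  refine Measurable.iInf fun n => measurable_const.mul (Measurable.sub ?_ ?_)
  · refine hF.measurable_comp (hq.add_const _) fun t => ?_
    have := hq0 t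
    positivity
  · exact hF.measurable_comp hq hq0

end MemFrakF

/-- The rearrangement inequality for the tangent minorants with bounded slope-height product. -/
lemma lintegral_truncation_le {a F : ℝ → ℝ → ℝ} (ha : Weight a) (hF : MemFrakF F) (hC : CondC a)
    {u : ℝ → ℝ} (hu : MemW11 u) (hpin : u (-1) = 0) {M : ℝ}
    (hM : ∀ x ∈ Icc (-1 : ℝ) 1, u x ≤ M) (hnn : ∀ x ∈ Icc (-1 : ℝ) 1, 0 ≤ u x)
    {P c : ℝ → ℝ} (hP : Measurable P) (hc : Measurable c) (hP0 : ∀ t, 0 ≤ P t)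
    (hc0 : ∀ t, 0 ≤ c t)
    (hPw : ∀ x ∈ Ioo (-1 : ℝ) 1, P (mrear u x) = a x (mrear u x) * |deriv (mrear u) x|)
    (htan : ∀ t, 0 ≤ t → ∀ q, 0 ≤ q → F t (P t) + c t * (q - P t) ≤ F t q) (n : ℝ) :
    ∫⁻ x in Icc (-1 : ℝ) 1, ENNReal.ofReal
      (F (max (mrear u x) 0) ({t | c t * P t ≤ n}.indicator P (mrear u x))) ≤ Ifun F a u := by
  set B : Set ℝ := {t | c t * P t ≤ n} with hB
  have hBm : MeasurableSet B := measurableSet_le (hc.mul hP) measurable_const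
  have hPB0 : ∀ t, 0 ≤ B.indicator P t := indicator_nonneg fun t _ => hP0 t
  have hcB0 : ∀ t, 0 ≤ B.indicator c t := indicator_nonneg fun t _ => hc0 t
  have hPBm : Measurable (B.indicator P) := hP.indicator hBm
  have hcBm : Measurable (B.indicator c) := hc.indicator hBm
  have hum : AEMeasurable u (volume.restrict (Icc (-1 : ℝ) 1)) :=
    hu.continuousOn.aemeasurable measurableSet_Icc
  set φ : ℝ → ℝ≥0∞ := fun t => ENNReal.ofReal (F (max t 0) (B.indicator P t)) with hφ
  have hφm : Measurable φ := (hF.measurable_comp hPBm hPB0).ennreal_ofReal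
  set ψ : ℝ → ℝ≥0∞ := fun t => ENNReal.ofReal (B.indicator c t * B.indicator P t) with hψ
  have hψm : Measurable ψ := (hcBm.mul hPBm).ennreal_ofReal
  have hpt : ∀ x ∈ Icc (-1 : ℝ) 1,
      φ (u x) + ENNReal.ofReal (B.indicator c (u x)) * ENNReal.ofReal (a x (u x) * |deriv u x|) ≤
        ENNReal.ofReal (F (u x) (a x (u x) * |deriv u x|)) + ψ (u x) := by
    intro x hx
    have hv := hnn x hx
    have hq : 0 ≤ a x (u x) * |deriv u x| := mul_nonneg (ha.2 _ _ hx hv) (abs_nonneg _)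
    simp only [hφ, hψ]
    rw [max_eq_left hv, ← ENNReal.ofReal_mul (hcB0 _),
      ← ENNReal.ofReal_add (hF.2.1 _ _ hv (hPB0 _)) (mul_nonneg (hcB0 _) hq),
      ← ENNReal.ofReal_add (hF.2.1 _ _ hv hq) (mul_nonneg (hcB0 _) (hPB0 _))]
    refine ENNReal.ofReal_le_ofReal ?_
    by_cases h : u x ∈ B
    · simp only [indicator_of_mem h]
      have := htan _ hv _ hq
      linarith
    · simp only [indicator_of_notMem h, zero_mul, add_zero]
      exact hF.2.2.2 _ hv (mem_Ici.2 le_rfl) (mem_Ici.2 hq) hq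
  have hsum := setLIntegral_mono' measurableSet_Icc hpt (μ := volume)
  rw [lintegral_add_left' (f := fun x => φ (u x)) (hφm.comp_aemeasurable hum),
    lintegral_add_right' (g := fun x => ψ (u x)) _ (hψm.comp_aemeasurable hum)] at hsum
  have hψle : ∫⁻ x in Icc (-1 : ℝ) 1, ψ (u x) ≤ ∫⁻ x in Icc (-1 : ℝ) 1,
      ENNReal.ofReal (B.indicator c (u x)) * ENNReal.ofReal (a x (u x) * |deriv u x|) := by
    rw [← lintegral_comp_mrear hM hu.continuousOn hnn hψm]
    refine le_trans ?_ (lintegral_weight_deriv_mrear_le ha hC hu hpin hM hnn hcBm.ennreal_ofReal)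
    rw [← Measure.restrict_congr_set (Ioo_ae_eq_Icc (μ := volume) (a := (-1 : ℝ)) (b := 1))]
    refine setLIntegral_mono' measurableSet_Ioo fun x hx => ?_
    rw [← ENNReal.ofReal_mul (hcB0 _), ← hPw x hx]
    exact ENNReal.ofReal_le_ofReal (mul_le_mul_of_nonneg_left
      (indicator_le_self' (fun t _ => hP0 t) _) (hcB0 _))
  have hψfin : ∫⁻ x in Icc (-1 : ℝ) 1, ψ (u x) ≠ ∞ := by
    refine ne_top_of_le_ne_top ?_ (lintegral_mono (g := fun _ => ENNReal.ofReal n) fun x => ?_)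
    · rw [setLIntegral_const]
      exact ENNReal.mul_ne_top ENNReal.ofReal_ne_top (by simp)
    · simp only [hψ]
      by_cases h : u x ∈ B
      · simp only [indicator_of_mem h]
        exact ENNReal.ofReal_le_ofReal h
      · simp [indicator_of_notMem h]
  rw [lintegral_comp_mrear hM hu.continuousOn hnn hφm]
  exact ENNReal.le_of_add_le_add_right hψfin ((add_le_add_right hψle _).trans hsum)

/-- `I(a,u*) ≤ I(a,u)` for nonnegative `u ∈ W¹₁(-1,1)` with `u(-1) = 0`, for any
continuous weight satisfying condition (C) (no evenness assumed). -/
theorem stmt16 (a F : ℝ → ℝ → ℝ) (ha : Weight a) (hF : MemFrakF F)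
    (hC : CondC a)
    (u : ℝ → ℝ) (hu : MemW11 u) (hnn : ∀ x ∈ Icc (-1 : ℝ) 1, 0 ≤ u x)
    (hpin : u (-1) = 0) :
    Ifun F a (mrear u) ≤ Ifun F a u := by
  obtain ⟨M, hM'⟩ := isCompact_Icc.bddAbove_image hu.continuousOn
  have hM : ∀ x ∈ Icc (-1 : ℝ) 1, u x ≤ M := fun x hx => hM' (mem_image_of_mem u hx)
  set P : ℝ → ℝ := fun t => a (clamp (levelPoint u t)) (max t 0) * levelSlope u t with hPdef
  have hPm : Measurable P := (ha.continuous_comp_clamp.measurable.comp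
    ((levelPoint_mono u).measurable.prodMk measurable_id)).mul (measurable_levelSlope u)
  have hP0 : ∀ t, 0 ≤ P t := fun t =>
    mul_nonneg (ha.2 _ _ (clamp_mem _) (le_max_right _ _)) (levelSlope_nonneg u t)
  have hPw : ∀ x ∈ Ioo (-1 : ℝ) 1, P (mrear u x) = a x (mrear u x) * |deriv (mrear u) x| := by
    intro x hx
    simp only [hPdef]
    rw [mul_levelSlope_mrear hM hx fun z => a (clamp z) (max (mrear u x) 0),
      clamp_of_mem (Ioo_subset_Icc_self hx), max_eq_left (mrear_nonneg u x)]
  set c : ℝ → ℝ := fun t => rightSlope (F (max t 0)) (P t) with hcdef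
  have hmax : ∀ t : ℝ, 0 ≤ max t 0 := fun t => le_max_right _ _
  have hc0 : ∀ t, 0 ≤ c t := fun t => rightSlope_nonneg (hF.2.2.2 _ (hmax t)) (hP0 t)
  have htan : ∀ t, 0 ≤ t → ∀ q, 0 ≤ q → F t (P t) + c t * (q - P t) ≤ F t q := by
    intro t ht q hq
    simp only [hcdef, max_eq_left ht]
    exact add_rightSlope_mul_le (hF.2.2.1 t ht) (hF.2.2.2 t ht) (hP0 t) hq
  have hle := fun n : ℕ => lintegral_truncation_le ha hF hC hu hpin hM hnn hPm
    (hF.measurable_rightSlope hPm hP0) hP0 hc0 hPw htan n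
  refine le_trans (le_trans (le_of_eq ?_) (lintegral_liminf_le' (u := atTop)
    (f := fun (n : ℕ) x => ENNReal.ofReal
      (F (max (mrear u x) 0) ({t | c t * P t ≤ n}.indicator P (mrear u x)))) fun n => ?_))
    (liminf_le_of_frequently_le' (Frequently.of_forall hle))
  · rw [Ifun]
    refine lintegral_congr_ae ?_
    rw [← Measure.restrict_congr_set (Ioo_ae_eq_Icc (μ := volume) (a := (-1 : ℝ)) (b := 1))]
    refine (ae_restrict_iff' measurableSet_Ioo).2 (Eventually.of_forall fun x hx => ?_)
    refine (Tendsto.liminf_eq (tendsto_const_nhds.congr' ?_)).symm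
    filter_upwards [eventually_ge_atTop ⌈c (mrear u x) * P (mrear u x)⌉₊] with n hn
    have hB : mrear u x ∈ {t | c t * P t ≤ n} := mem_ofPred_eq.mpr (Nat.ceil_le.1 hn)
    rw [indicator_of_mem hB, hPw x hx,
      max_eq_left (mrear_nonneg u x)]
  · have hB : MeasurableSet {t | c t * P t ≤ n} :=
      measurableSet_le ((hF.measurable_rightSlope hPm hP0).mul hPm) measurable_const
    exact (hF.measurable_comp (hPm.indicator hB)
      (indicator_nonneg fun t _ => hP0 t)).ennreal_ofReal.comp_aemeasurable (aemeasurable_mrear hM)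
end
end

section
/- Let a : [-1,1] × [0,∞) → [0,∞) be continuous. If for every F ∈ 𝔉 the inequality I(a,ū) ≤ I(a,u) holds for every nonnegative piecewise linear function u on [-1,1] with u(-1) = u(1), then a satisfies condition (C'), i.e. a(s,v) + a(t,v) ≥ a((s-t)/2, v) + a((t-s)/2, v) for all s, t ∈ [-1,1] and all v ≥ 0. -/
open MeasureTheory Set Filter
open scoped ENNReal BigOperators NNReal

noncomputable section

/-- The trapezoidal profile of base height `v`, rising with slope `1` from `s` to `s + δ` and
falling with slope `-1` from `t - δ` to `t`. -/
def trapezoid (s t v δ x : ℝ) : ℝ := v + max 0 (min δ (min (x - s) (t - x)))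

lemma le_trapezoid (s t v δ x : ℝ) : v ≤ trapezoid s t v δ x := by
  unfold trapezoid
  linarith [le_max_left 0 (min δ (min (x - s) (t - x)))]

lemma trapezoid_le (s t v : ℝ) {δ : ℝ} (hδ : 0 ≤ δ) (x : ℝ) :
    trapezoid s t v δ x ≤ v + δ := by
  unfold trapezoid
  linarith [max_le hδ (min_le_left δ (min (x - s) (t - x)))]

lemma lt_trapezoid_iff {s t v δ τ x : ℝ} :
    τ < trapezoid s t v δ x ↔ τ < v ∨ (τ < v + δ ∧ s + (τ - v) < x ∧ x < t - (τ - v)) := by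
  unfold trapezoid
  rw [← sub_lt_iff_lt_add', lt_max_iff, lt_min_iff, lt_min_iff]
  refine or_congr (by constructor <;> intro h <;> linarith) (and_congr ?_ (and_congr ?_ ?_)) <;>
  constructor <;> intro h <;> linarith

lemma lipschitzWith_trapezoid (s t v δ : ℝ) : LipschitzWith 1 (trapezoid s t v δ) := by
  have h1 : LipschitzWith 1 (fun x : ℝ => x - s) :=
    LipschitzWith.of_dist_le_mul fun x y => by simp
  have h2 : LipschitzWith 1 (fun x : ℝ => t - x) :=
    LipschitzWith.of_dist_le_mul fun x y => by
      rw [dist_sub_left, NNReal.coe_one, one_mul]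
  have h3 : LipschitzWith 1 (fun x : ℝ => max 0 (min δ (min (x - s) (t - x)))) := by
    simpa using ((h1.min h2).const_min δ).const_max 0
  refine LipschitzWith.of_dist_le_mul fun x y => ?_
  simpa [trapezoid] using h3.dist_le_mul x y

lemma abs_deriv_trapezoid_le (s t v δ x : ℝ) : |deriv (trapezoid s t v δ) x| ≤ 1 := by
  simpa using norm_deriv_le_of_lipschitz (x₀ := x) (lipschitzWith_trapezoid s t v δ)

lemma deriv_trapezoid_eq_zero {s t v δ x : ℝ} (hδ : 0 ≤ δ)
    (h1 : x ∉ Icc s (s + δ)) (h2 : x ∉ Icc (t - δ) t) :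
    deriv (trapezoid s t v δ) x = 0 := by
  have key : ∀ U : Set ℝ, IsOpen U → x ∈ U → (∃ c, ∀ y ∈ U, trapezoid s t v δ y = c) →
      deriv (trapezoid s t v δ) x = 0 := by
    rintro U hU hx ⟨c, hc⟩
    have : trapezoid s t v δ =ᶠ[nhds x] fun _ => c := by
      filter_upwards [hU.mem_nhds hx] with y hy using hc y hy
    rw [this.deriv_eq, deriv_const]
  have outside : ∀ y, min (y - s) (t - y) ≤ 0 → trapezoid s t v δ y = v := fun y hy => by
    unfold trapezoid
    rw [max_eq_left ((min_le_right _ _).trans hy), add_zero]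
  rcases lt_or_ge x s with hxs | hxs
  · exact key (Iio s) isOpen_Iio hxs
      ⟨v, fun y hy => outside y (min_le_of_left_le (sub_nonpos.2 (le_of_lt hy)))⟩
  rcases lt_or_ge t x with hxt | hxt
  · exact key (Ioi t) isOpen_Ioi hxt
      ⟨v, fun y hy => outside y (min_le_of_right_le (sub_nonpos.2 (le_of_lt hy)))⟩
  have h3 : s + δ < x := by by_contra h; exact h1 ⟨hxs, not_lt.1 h⟩
  have h4 : x < t - δ := by by_contra h; exact h2 ⟨not_lt.1 h, hxt⟩
  refine key (Ioo (s + δ) (t - δ)) isOpen_Ioo ⟨h3, h4⟩ ⟨v + δ, fun y hy => ?_⟩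
  unfold trapezoid
  rw [min_eq_left (le_min (by linarith [hy.1]) (by linarith [hy.2])), max_eq_right hδ]

lemma piecewiseLinear_trapezoid {s t v δ : ℝ} (hs : -1 < s) (ht : t < 1) (hδ : 0 < δ)
    (hst : 2 * δ < t - s) : PiecewiseLinear (trapezoid s t v δ) := by
  refine ⟨5, ![-1, s, s + δ, t - δ, t, 1], rfl, rfl, ?_, ?_⟩
  · rw [Fin.strictMono_iff_lt_succ]
    intro i
    fin_cases i <;> simp <;> linarith
  · intro i
    fin_cases i
    · refine ⟨0, v, fun y hy => ?_⟩
      have h1 : y ≤ s := hy.2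
      unfold trapezoid
      rw [max_eq_left (min_le_of_right_le (min_le_of_left_le (by linarith)))]; ring
    · refine ⟨1, v - s, fun y hy => ?_⟩
      have h1 : s ≤ y := hy.1
      have h2 : y ≤ s + δ := hy.2
      unfold trapezoid
      rw [min_eq_left (b := t - y) (by linarith), min_eq_right (by linarith),
        max_eq_right (by linarith)]; ring
    · refine ⟨0, v + δ, fun y hy => ?_⟩
      have h1 : s + δ ≤ y := hy.1
      have h2 : y ≤ t - δ := hy.2
      unfold trapezoid
      rw [min_eq_left (le_min (by linarith) (by linarith)), max_eq_right hδ.le]; ring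
    · refine ⟨-1, v + t, fun y hy => ?_⟩
      have h1 : t - δ ≤ y := hy.1
      have h2 : y ≤ t := hy.2
      unfold trapezoid
      rw [min_eq_right (a := y - s) (by linarith), min_eq_right (by linarith),
        max_eq_right (by linarith)]; ring
    · refine ⟨0, v, fun y hy => ?_⟩
      have h1 : t ≤ y := hy.1
      unfold trapezoid
      rw [max_eq_left (min_le_of_right_le (min_le_of_right_le (by linarith)))]; ring

lemma trapezoid_of_le {s t v δ x : ℝ} (h : x ≤ s ∨ t ≤ x) : trapezoid s t v δ x = v := by
  unfold trapezoid
  rw [max_eq_left, add_zero]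
  refine min_le_of_right_le ?_
  rcases h with h | h
  · exact min_le_of_left_le (by linarith)
  · exact min_le_of_right_le (by linarith)

lemma abs_le_half_volume_trapezoid_iff {s t v δ τ x : ℝ} (hs : -1 < s) (ht : t < 1) (hδ : 0 < δ)
    (hst : 2 * δ < t - s) (hx1 : (t - s) / 2 - δ < |x|) (hx2 : |x| < (t - s) / 2) :
    |x| ≤ (volume {y ∈ Icc (-1 : ℝ) 1 | trapezoid s t v δ y > τ}).toReal / 2 ↔
      τ ≤ v + (t - s) / 2 - |x| := by
  rcases lt_or_ge τ v with h | h
  · have : {y ∈ Icc (-1 : ℝ) 1 | trapezoid s t v δ y > τ} = Icc (-1) 1 := by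
      ext y
      simp only [mem_ofPred_eq, and_iff_left_iff_imp]
      exact fun _ => h.trans_le (le_trapezoid _ _ _ _ _)
    rw [this, Real.volume_Icc, ENNReal.toReal_ofReal (by norm_num)]
    constructor <;> intro _ <;> linarith
  rcases lt_or_ge τ (v + δ) with h' | h'
  · have : {y ∈ Icc (-1 : ℝ) 1 | trapezoid s t v δ y > τ} =
        Ioo (s + (τ - v)) (t - (τ - v)) := by
      ext y
      simp only [mem_ofPred_eq, gt_iff_lt, lt_trapezoid_iff, mem_Icc, mem_Ioo, h', true_and]
      constructor
      · rintro ⟨-, h1 | h1⟩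
        · linarith
        · exact h1
      · intro h1
        exact ⟨⟨by linarith, by linarith⟩, Or.inr h1⟩
    rw [this, Real.volume_Ioo, ENNReal.toReal_ofReal (by linarith)]
    constructor <;> intro _ <;> linarith
  · have : {y ∈ Icc (-1 : ℝ) 1 | trapezoid s t v δ y > τ} = ∅ := by
      ext y
      simp only [mem_ofPred_eq, mem_empty_iff_false, iff_false, not_and, gt_iff_lt, not_lt]
      exact fun _ => (trapezoid_le s t v hδ.le y).trans h'
    rw [this]
    simp only [measure_empty, ENNReal.toReal_zero, zero_div]
    constructor <;> intro _ <;> linarith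

/-- On its slopes, the symmetrized trapezoid is the symmetric trapezoid. -/
lemma srear_trapezoid {s t v δ x : ℝ} (hs : -1 < s) (ht : t < 1) (hv : 0 ≤ v) (hδ : 0 < δ)
    (hst : 2 * δ < t - s) (hx1 : (t - s) / 2 - δ < |x|) (hx2 : |x| < (t - s) / 2) :
    srear (trapezoid s t v δ) x = v + (t - s) / 2 - |x| := by
  have : srear (trapezoid s t v δ) x =
      ∫ τ in Ioi (0 : ℝ), (Iic (v + (t - s) / 2 - |x|)).indicator (fun _ => (1 : ℝ)) τ := by
    refine integral_congr_ae (Eventually.of_forall fun τ => ?_)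
    have h := abs_le_half_volume_trapezoid_iff (v := v) (τ := τ) hs ht hδ hst hx1 hx2
    rw [abs_le] at h
    simp only [indicator]
    exact if_congr h rfl rfl
  rw [this, setIntegral_indicator measurableSet_Iic, Ioi_inter_Iic]
  simp only [integral_const, smul_eq_mul, mul_one, measureReal_restrict_apply_univ,
    Real.volume_real_Ioc, sub_zero]
  exact max_eq_left (by linarith)

lemma abs_deriv_srear_trapezoid {s t v δ x : ℝ} (hs : -1 < s) (ht : t < 1) (hv : 0 ≤ v)
    (hδ : 0 < δ) (hst : 2 * δ < t - s) (hx1 : (t - s) / 2 - δ < |x|)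
    (hx2 : |x| < (t - s) / 2) :
    |deriv (srear (trapezoid s t v δ)) x| = 1 := by
  have hx0 : x ≠ 0 := by
    rintro rfl
    rw [abs_zero] at hx1
    linarith
  have : srear (trapezoid s t v δ) =ᶠ[nhds x] fun y => v + (t - s) / 2 - |y| := by
    have ho : IsOpen {y : ℝ | (t - s) / 2 - δ < |y| ∧ |y| < (t - s) / 2} :=
      (isOpen_lt continuous_const continuous_abs).inter
        (isOpen_lt continuous_abs continuous_const)
    filter_upwards [ho.mem_nhds ⟨hx1, hx2⟩] with y hy
      using srear_trapezoid hs ht hv hδ hst hy.1 hy.2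
  rw [this.deriv_eq, deriv_const_sub, abs_neg]
  rcases lt_or_gt_of_ne hx0 with h | h
  · rw [deriv_abs_neg h]; norm_num
  · rw [deriv_abs_pos h]; norm_num

lemma memFrakF_snd : MemFrakF fun _ p => p :=
  ⟨continuous_snd.continuousOn, fun _ _ _ hp => hp, fun _ _ => convexOn_id (convex_Ici 0),
    fun _ _ => monotoneOn_id⟩

lemma Weight.exists_forall_abs_sub_lt {a : ℝ → ℝ → ℝ} (ha : Weight a) {x v ε : ℝ}
    (hx : x ∈ Icc (-1 : ℝ) 1) (hv : 0 ≤ v) (hε : 0 < ε) :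
    ∃ η > 0, ∀ y ∈ Icc (-1 : ℝ) 1, |y - x| < η → ∀ w, 0 ≤ w → |w - v| < η →
      |a y w - a x v| < ε := by
  obtain ⟨η, hη, h⟩ := Metric.continuousOn_iff.1 ha.1 (x, v) ⟨hx, hv⟩ ε hε
  refine ⟨η, hη, fun y hy hyx w hw hwv => ?_⟩
  have := h (y, w) ⟨hy, hw⟩ (by
    rw [Prod.dist_eq, Real.dist_eq, Real.dist_eq]
    exact max_lt hyx hwv)
  rwa [Real.dist_eq] at this

/-- An upper bound for the weighted variation of a trapezoid. -/
lemma Ifun_trapezoid_le {a : ℝ → ℝ → ℝ} (ha : Weight a) {s t v δ A B : ℝ} (hv : 0 ≤ v)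
    (hδ : 0 ≤ δ)
    (hA : ∀ x ∈ Icc (-1 : ℝ) 1, x ∈ Icc s (s + δ) → ∀ w ∈ Icc v (v + δ), a x w ≤ A)
    (hB : ∀ x ∈ Icc (-1 : ℝ) 1, x ∈ Icc (t - δ) t → ∀ w ∈ Icc v (v + δ), a x w ≤ B) :
    Ifun (fun _ p => p) a (trapezoid s t v δ) ≤
      ENNReal.ofReal A * ENNReal.ofReal δ + ENNReal.ofReal B * ENNReal.ofReal δ := by
  let f := (Icc s (s + δ)).indicator fun _ : ℝ => ENNReal.ofReal A
  let g := (Icc (t - δ) t).indicator fun _ : ℝ => ENNReal.ofReal B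
  calc Ifun (fun _ p => p) a (trapezoid s t v δ)
      ≤ ∫⁻ x in Icc (-1 : ℝ) 1, (f x + g x) := by
        refine setLIntegral_mono' measurableSet_Icc fun x hx => ?_
        have hw : trapezoid s t v δ x ∈ Icc v (v + δ) :=
          ⟨le_trapezoid _ _ _ _ _, trapezoid_le _ _ _ hδ _⟩
        have hle : a x (trapezoid s t v δ x) * |deriv (trapezoid s t v δ) x| ≤
            a x (trapezoid s t v δ x) :=
          mul_le_of_le_one_right (ha.2 _ _ hx (hv.trans hw.1)) (abs_deriv_trapezoid_le _ _ _ _ _)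
        by_cases h1 : x ∈ Icc s (s + δ)
        · refine le_add_right ?_
          simp only [f, indicator_of_mem h1]
          exact ENNReal.ofReal_le_ofReal (hle.trans (hA x hx h1 _ hw))
        by_cases h2 : x ∈ Icc (t - δ) t
        · refine le_add_left ?_
          simp only [g, indicator_of_mem h2]
          exact ENNReal.ofReal_le_ofReal (hle.trans (hB x hx h2 _ hw))
        · simp [deriv_trapezoid_eq_zero hδ h1 h2]
    _ ≤ ∫⁻ x, (f x + g x) := setLIntegral_le_lintegral _ _
    _ = _ := by
        rw [lintegral_add_left (measurable_const.indicator measurableSet_Icc),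
          lintegral_indicator_const measurableSet_Icc,
          lintegral_indicator_const measurableSet_Icc, Real.volume_Icc, Real.volume_Icc]
        simp

/-- A lower bound for the weighted variation of a symmetrized trapezoid. -/
lemma le_Ifun_srear_trapezoid {a : ℝ → ℝ → ℝ} {s t v δ A B : ℝ} (hs : -1 < s) (ht : t < 1)
    (hv : 0 ≤ v) (hδ : 0 < δ) (hst : 2 * δ < t - s)
    (hA : ∀ x ∈ Ioo (-((t - s) / 2)) (-((t - s) / 2) + δ), ∀ w ∈ Icc v (v + δ), A ≤ a x w)
    (hB : ∀ x ∈ Ioo ((t - s) / 2 - δ) ((t - s) / 2), ∀ w ∈ Icc v (v + δ), B ≤ a x w) :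
    ENNReal.ofReal A * ENNReal.ofReal δ + ENNReal.ofReal B * ENNReal.ofReal δ ≤
      Ifun (fun _ p => p) a (srear (trapezoid s t v δ)) := by
  set h := (t - s) / 2 with hh
  have hpt : ∀ x, h - δ < |x| → |x| < h → ∀ C, (∀ w ∈ Icc v (v + δ), C ≤ a x w) →
      C ≤ a x (srear (trapezoid s t v δ) x) * |deriv (srear (trapezoid s t v δ)) x| := by
    intro x h1 h2 C hC
    rw [abs_deriv_srear_trapezoid hs ht hv hδ hst h1 h2, mul_one,
      srear_trapezoid hs ht hv hδ hst h1 h2]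
    exact hC _ ⟨by linarith, by linarith⟩
  have hdisj : Disjoint (Ioo (-h) (-h + δ)) (Ioo (h - δ) h) :=
    Set.disjoint_left.2 fun x h1 h2 => by linarith [h1.2, h2.1]
  calc ENNReal.ofReal A * ENNReal.ofReal δ + ENNReal.ofReal B * ENNReal.ofReal δ
      = (∫⁻ _ in Ioo (-h) (-h + δ), ENNReal.ofReal A) +
          ∫⁻ _ in Ioo (h - δ) h, ENNReal.ofReal B := by
        rw [setLIntegral_const, setLIntegral_const, Real.volume_Ioo, Real.volume_Ioo]
        simp
    _ ≤ (∫⁻ x in Ioo (-h) (-h + δ), ENNReal.ofReal (a x (srear (trapezoid s t v δ) x) *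
            |deriv (srear (trapezoid s t v δ)) x|)) +
          ∫⁻ x in Ioo (h - δ) h, ENNReal.ofReal (a x (srear (trapezoid s t v δ) x) *
            |deriv (srear (trapezoid s t v δ)) x|) := by
        refine add_le_add (setLIntegral_mono' measurableSet_Ioo fun x hx => ?_)
          (setLIntegral_mono' measurableSet_Ioo fun x hx => ?_)
        · have hx0 : |x| = -x := abs_of_neg (by linarith [hx.2])
          exact ENNReal.ofReal_le_ofReal
            (hpt x (by linarith [hx.2]) (by linarith [hx.1]) A (hA x hx))
        · have hx0 : |x| = x := abs_of_pos (by linarith [hx.1])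
          exact ENNReal.ofReal_le_ofReal
            (hpt x (by linarith [hx.1]) (by linarith [hx.2]) B (hB x hx))
    _ = ∫⁻ x in Ioo (-h) (-h + δ) ∪ Ioo (h - δ) h,
          ENNReal.ofReal (a x (srear (trapezoid s t v δ) x) *
            |deriv (srear (trapezoid s t v δ)) x|) :=
        (lintegral_union measurableSet_Ioo hdisj).symm
    _ ≤ _ := by
        refine lintegral_mono_set (union_subset (fun x hx => ?_) fun x hx => ?_)
        · exact ⟨by linarith [hx.1], by linarith [hx.2]⟩
        · exact ⟨by linarith [hx.1], by linarith [hx.2]⟩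

/-- The inequality of condition (C') at ordered interior points. -/
lemma condC'_of_lt {a : ℝ → ℝ → ℝ} (ha : Weight a)
    (H : ∀ u : ℝ → ℝ, PiecewiseLinear u → (∀ x ∈ Icc (-1 : ℝ) 1, 0 ≤ u x) →
        u (-1) = u 1 → Ifun (fun _ p => p) a (srear u) ≤ Ifun (fun _ p => p) a u)
    {s t v : ℝ} (hs : -1 < s) (hst : s < t) (ht : t < 1) (hv : 0 ≤ v) :
    a ((s - t) / 2) v + a ((t - s) / 2) v ≤ a s v + a t v := by
  refine le_of_forall_pos_le_add fun ε hε => ?_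
  have hsI : s ∈ Icc (-1 : ℝ) 1 := ⟨by linarith, by linarith⟩
  have htI : t ∈ Icc (-1 : ℝ) 1 := ⟨by linarith, by linarith⟩
  have hε4 : 0 < ε / 4 := by linarith
  obtain ⟨η₁, hη₁, h₁⟩ := ha.exists_forall_abs_sub_lt hsI hv hε4
  obtain ⟨η₂, hη₂, h₂⟩ := ha.exists_forall_abs_sub_lt htI hv hε4
  obtain ⟨η₃, hη₃, h₃⟩ := ha.exists_forall_abs_sub_lt (x := (s - t) / 2)
    ⟨by linarith, by linarith⟩ hv hε4
  obtain ⟨η₄, hη₄, h₄⟩ := ha.exists_forall_abs_sub_lt (x := (t - s) / 2)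
    ⟨by linarith, by linarith⟩ hv hε4
  obtain ⟨δ, hδ, hδ'⟩ := exists_between
    (lt_min (lt_min hη₁ hη₂) (lt_min (lt_min hη₃ hη₄) (by linarith : 0 < (t - s) / 2)))
  simp only [lt_min_iff] at hδ'
  obtain ⟨⟨l₁, l₂⟩, ⟨l₃, l₄⟩, l₅⟩ := hδ'
  have hδst : 2 * δ < t - s := by linarith
  have hw : ∀ w ∈ Icc v (v + δ), 0 ≤ w ∧ |w - v| ≤ δ := fun w hw =>
    ⟨hv.trans hw.1, abs_le.2 ⟨by linarith [hw.1], by linarith [hw.2]⟩⟩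
  have upper := Ifun_trapezoid_le ha (s := s) (t := t) (A := a s v + ε / 4) (B := a t v + ε / 4)
    hv hδ.le
    (fun x hx hx' w hw' => by
      have := h₁ x hx (abs_lt.2 ⟨by linarith [hx'.1], by linarith [hx'.2]⟩) w (hw w hw').1
        ((hw w hw').2.trans_lt l₁)
      linarith [(abs_lt.1 this).2])
    (fun x hx hx' w hw' => by
      have := h₂ x hx (abs_lt.2 ⟨by linarith [hx'.1], by linarith [hx'.2]⟩) w (hw w hw').1
        ((hw w hw').2.trans_lt l₂)
      linarith [(abs_lt.1 this).2])
  have lower := le_Ifun_srear_trapezoid (a := a) (A := a ((s - t) / 2) v - ε / 4)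
    (B := a ((t - s) / 2) v - ε / 4) hs ht hv hδ hδst
    (fun x hx w hw' => by
      have := h₃ x ⟨by linarith [hx.1], by linarith [hx.2]⟩
        (abs_lt.2 ⟨by linarith [hx.1], by linarith [hx.2]⟩) w (hw w hw').1
        ((hw w hw').2.trans_lt l₃)
      linarith [(abs_lt.1 this).1])
    (fun x hx w hw' => by
      have := h₄ x ⟨by linarith [hx.1], by linarith [hx.2]⟩
        (abs_lt.2 ⟨by linarith [hx.1], by linarith [hx.2]⟩) w (hw w hw').1
        ((hw w hw').2.trans_lt l₄)
      linarith [(abs_lt.1 this).1])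
  have main := (lower.trans (H _ (piecewiseLinear_trapezoid hs ht hδ hδst)
    (fun x _ => hv.trans (le_trapezoid _ _ _ _ _))
    (by rw [trapezoid_of_le (Or.inl hs.le), trapezoid_of_le (Or.inr ht.le)]))).trans upper
  have has := ha.2 s v hsI hv
  have hat := ha.2 t v htI hv
  rw [← add_mul, ← add_mul, ENNReal.mul_le_mul_iff_left (ENNReal.ofReal_pos.2 hδ).ne'
    ENNReal.ofReal_ne_top,
    ← ENNReal.ofReal_add (p := a s v + ε / 4) (by linarith) (by linarith)] at main
  have := (ENNReal.ofReal_le_ofReal_iff (by linarith)).1 (ENNReal.ofReal_add_le.trans main)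
  linarith

/-- The inequality of condition (C') extends by continuity from ordered interior points. -/
lemma Weight.condC'_of_forall_lt {a : ℝ → ℝ → ℝ} (ha : Weight a)
    (h : ∀ s t v : ℝ, -1 < s → s < t → t < 1 → 0 ≤ v →
      a ((s - t) / 2) v + a ((t - s) / 2) v ≤ a s v + a t v) : CondC' a := by
  have ordered : ∀ s t v : ℝ, -1 ≤ s → s ≤ t → t ≤ 1 → 0 ≤ v →
      a ((s - t) / 2) v + a ((t - s) / 2) v ≤ a s v + a t v := by
    intro s t v hs hst ht hv
    let p : ℝ → ℝ := fun θ => s + θ * (-1 / 2 - s)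
    let q : ℝ → ℝ := fun θ => t + θ * (1 / 2 - t)
    have hp : Continuous p := by fun_prop
    have hq : Continuous q := by fun_prop
    have hpq : ∀ θ ∈ Ioc (0 : ℝ) 1, -1 < p θ ∧ p θ < q θ ∧ q θ < 1 := by
      rintro θ ⟨h0, h1⟩
      refine ⟨?_, ?_, ?_⟩ <;> simp only [p, q] <;> nlinarith
    have hcont : ∀ f : ℝ → ℝ, Continuous f → (∀ θ ∈ Ioc (0 : ℝ) 1, f θ ∈ Icc (-1 : ℝ) 1) →
        f 0 ∈ Icc (-1 : ℝ) 1 →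
        ContinuousWithinAt (fun θ => a (f θ) v) (Ioc 0 1) 0 := fun f hf hfI hf0 =>
      ContinuousWithinAt.comp (f := fun θ => (f θ, v)) (ha.1 (f 0, v) ⟨hf0, hv⟩)
        (hf.prodMk continuous_const).continuousWithinAt (fun θ hθ => ⟨hfI θ hθ, hv⟩)
    have h0 : (0 : ℝ) ∈ closure (Ioc (0 : ℝ) 1) := by
      rw [closure_Ioc zero_ne_one]; simp
    have key := ContinuousWithinAt.closure_le h0
      ((hcont (fun θ => (p θ - q θ) / 2) (by fun_prop)
        (fun θ hθ => by obtain ⟨h1, h2, h3⟩ := hpq θ hθ; constructor <;> linarith)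
        (by simp only [p, q, zero_mul, add_zero]; constructor <;> linarith)).add
      (hcont (fun θ => (q θ - p θ) / 2) (by fun_prop)
        (fun θ hθ => by obtain ⟨h1, h2, h3⟩ := hpq θ hθ; constructor <;> linarith)
        (by simp only [p, q, zero_mul, add_zero]; constructor <;> linarith)))
      ((hcont p hp
        (fun θ hθ => by obtain ⟨h1, h2, h3⟩ := hpq θ hθ; constructor <;> linarith)
        (by simp only [p, zero_mul, add_zero]; constructor <;> linarith)).add
      (hcont q hq
        (fun θ hθ => by obtain ⟨h1, h2, h3⟩ := hpq θ hθ; constructor <;> linarith)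
        (by simp only [q, zero_mul, add_zero]; constructor <;> linarith)))
      (fun θ hθ => h _ _ v (hpq θ hθ).1 (hpq θ hθ).2.1 (hpq θ hθ).2.2 hv)
    simpa [p, q] using key
  intro s t v hs ht hv
  rcases le_total s t with hst | hst
  · exact ordered s t v hs.1 hst ht.2 hv
  · linarith [ordered t s v ht.1 hst hs.2 hv]

/-- if `I(a,ū) ≤ I(a,u)` for every `F ∈ 𝔉` and every nonnegative piecewise
linear `u` with `u(-1) = u(1)`, then `a` satisfies condition (C'). -/
theorem stmt17 (a : ℝ → ℝ → ℝ) (ha : Weight a)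
    (H : ∀ F : ℝ → ℝ → ℝ, MemFrakF F →
      ∀ u : ℝ → ℝ, PiecewiseLinear u → (∀ x ∈ Icc (-1 : ℝ) 1, 0 ≤ u x) →
        u (-1) = u 1 → Ifun F a (srear u) ≤ Ifun F a u) :
    CondC' a := by
  exact ha.condC'_of_forall_lt fun _ _ _ hs hst ht hv =>
    condC'_of_lt ha (H _ memFrakF_snd) hs hst ht hv
end
end

section
/- Let a : [-1,1] × [0,∞) → [0,∞) be continuous and satisfy condition (C'). Then a is even and convex with respect to the first argument: for every v ≥ 0, a(-x,v) = a(x,v) for all x ∈ [-1,1], and the function x ↦ a(x,v) is convex on [-1,1]. -/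
open MeasureTheory Set Filter
open scoped ENNReal BigOperators NNReal

noncomputable section

/-- A continuous midpoint convex function on `[0,1]` that vanishes at the endpoints is nonpositive. -/
theorem nonpos_of_midpoint_convex {g : ℝ → ℝ} (hg : ContinuousOn g (Icc 0 1))
    (h0 : g 0 = 0) (h1 : g 1 = 0)
    (hmid : ∀ s ∈ Icc (0 : ℝ) 1, ∀ t ∈ Icc (0 : ℝ) 1, 2 * g ((s + t) / 2) ≤ g s + g t) :
    ∀ t ∈ Icc (0 : ℝ) 1, g t ≤ 0 := by
  obtain ⟨m, hm, hmax⟩ := isCompact_Icc.exists_isMaxOn (nonempty_Icc.2 zero_le_one) hg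
  have hclosed : IsClosed (Icc (0 : ℝ) 1 ∩ g ⁻¹' {g m}) :=
    hg.preimage_isClosed_of_isClosed isClosed_Icc isClosed_singleton
  obtain ⟨c, ⟨⟨hc0, hc1⟩, hcm⟩, hleast⟩ :=
    (isCompact_Icc.of_isClosed_subset hclosed inter_subset_left).exists_isLeast ⟨m, hm, rfl⟩
  rw [mem_preimage, mem_singleton_iff] at hcm
  by_contra! hpos
  obtain ⟨t, ht, hgt⟩ := hpos
  have hmpos : 0 < g m := hgt.trans_le (hmax ht)
  have hc0' : 0 < c := hc0.lt_of_ne (by rintro rfl; linarith)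
  have hc1' : c < 1 := hc1.lt_of_ne (by rintro rfl; linarith)
  obtain ⟨r, hr, hrc⟩ : ∃ r, 0 < r ∧ r ≤ min c (1 - c) :=
    ⟨min c (1 - c), lt_min hc0' (by linarith), le_rfl⟩
  obtain ⟨hr1, hr2⟩ := le_min_iff.1 hrc
  have hl : c - r ∈ Icc (0 : ℝ) 1 := ⟨by linarith, by linarith⟩
  have hu : c + r ∈ Icc (0 : ℝ) 1 := ⟨by linarith, by linarith⟩
  have hlt : g (c - r) < g m := (hmax hl).lt_of_ne fun h => by
    have := hleast ⟨hl, h⟩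
    linarith
  have hle : g (c + r) ≤ g m := hmax hu
  have h := hmid _ hl _ hu
  rw [show (c - r + (c + r)) / 2 = c by ring] at h
  linarith

/-- A continuous midpoint convex function on a convex subset of `ℝ` is convex. -/
theorem convexOn_of_midpoint_of_continuousOn {f : ℝ → ℝ} {S : Set ℝ} (hS : Convex ℝ S)
    (hf : ContinuousOn f S)
    (hmid : ∀ s ∈ S, ∀ t ∈ S, 2 * f ((s + t) / 2) ≤ f s + f t) : ConvexOn ℝ S f := by
  refine ⟨hS, fun x hx y hy p q hp hq hpq => ?_⟩
  have hmem : ∀ t ∈ Icc (0 : ℝ) 1, (1 - t) * x + t * y ∈ S := fun t ht =>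
    hS hx hy (sub_nonneg.2 ht.2) ht.1 (by ring)
  have key := nonpos_of_midpoint_convex
    (g := fun t => f ((1 - t) * x + t * y) - ((1 - t) * f x + t * f y))
    ((hf.comp (by fun_prop) hmem).sub (by fun_prop)) (by simp) (by simp)
    (fun s hs t ht => by
      have h := hmid _ (hmem s hs) _ (hmem t ht)
      rw [show ((1 - s) * x + s * y + ((1 - t) * x + t * y)) / 2
        = (1 - (s + t) / 2) * x + (s + t) / 2 * y by ring] at h
      linarith)
    q ⟨hq, by linarith⟩
  obtain rfl : p = 1 - q := by linarith
  simp only [smul_eq_mul]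
  linarith

/-- The one-variable form of condition (C') implies `f (-x) ≤ f x`. -/
theorem apply_neg_le_of_continuousOn {f : ℝ → ℝ} (hf : ContinuousOn f (Icc (-1) 1))
    (hC : ∀ s ∈ Icc (-1 : ℝ) 1, ∀ t ∈ Icc (-1 : ℝ) 1,
      f ((s - t) / 2) + f ((t - s) / 2) ≤ f s + f t)
    {x : ℝ} (hx : x ∈ Icc (-1 : ℝ) 1) : f (-x) ≤ f x := by
  have hmem : ∀ c : ℝ, |c| ≤ 1 → c * x ∈ Icc (-1 : ℝ) 1 := fun c hc => by
    rw [mem_Icc, ← abs_le, abs_mul]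
    exact mul_le_one₀ hc (abs_nonneg _) (abs_le.2 hx)
  have hchain : ∀ d : ℝ, 0 ≤ d → ∀ k : ℕ, (k + 1) * d ≤ 1 →
      f (d * x) - f 0 ≤ f ((k + 1) * d * x) - f (-(k * d) * x) := by
    intro d hd k
    induction k with
    | zero => intro _; simp
    | succ k ih =>
      intro hk
      push_cast at hk ⊢
      have hkd : 0 ≤ (k : ℝ) * d := by positivity
      have h := hC _ (hmem ((k + 1 + 1) * d) (abs_le.2 ⟨by linarith, hk⟩))
        _ (hmem (-(k * d)) (abs_le.2 ⟨by linarith, by linarith⟩))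
      rw [show ((k + 1 + 1) * d * x - -(k * d) * x) / 2 = (k + 1) * d * x by ring,
        show (-(k * d) * x - (k + 1 + 1) * d * x) / 2 = -((k + 1) * d) * x by ring] at h
      have := ih (by linarith)
      linarith
  have hstep : ∀ n : ℕ, f (1 / ((n : ℝ) + 1) * x) - f 0 ≤
      f x - f ((1 / ((n : ℝ) + 1) - 1) * x) := fun n => by
    have hn : ((n : ℝ) + 1) * (1 / ((n : ℝ) + 1)) = 1 := by field_simp
    have h := hchain (1 / ((n : ℝ) + 1)) (by positivity) n hn.le
    rw [hn, one_mul] at h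
    rwa [show 1 / ((n : ℝ) + 1) - 1 = -(n * (1 / ((n : ℝ) + 1))) by linarith]
  have hlim : Tendsto (fun n : ℕ => 1 / ((n : ℝ) + 1)) atTop (nhds 0) :=
    tendsto_one_div_add_atTop_nhds_zero_nat
  have hbound : ∀ n : ℕ, 0 ≤ 1 / ((n : ℝ) + 1) ∧ 1 / ((n : ℝ) + 1) ≤ 1 := fun n =>
    ⟨by positivity, by rw [div_le_one (by positivity)]; linarith [n.cast_nonneg (α := ℝ)]⟩
  have htendsto : ∀ b : ℝ, -1 ≤ b → b ≤ 0 →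
      Tendsto (fun n : ℕ => f ((1 / ((n : ℝ) + 1) + b) * x)) atTop (nhds (f (b * x))) :=
    fun b hb hb' => by
      have hb1 : |b| ≤ 1 := abs_le.2 ⟨hb, by linarith⟩
      refine (hf _ (hmem b hb1)).tendsto.comp (tendsto_nhdsWithin_iff.2 ⟨?_, ?_⟩)
      · simpa using (hlim.add_const b).mul_const x
      · exact Eventually.of_forall fun n => hmem _
          (abs_le.2 ⟨by linarith [(hbound n).1], by linarith [(hbound n).2]⟩)
  have h := le_of_tendsto_of_tendsto'
    ((htendsto 0 (by norm_num) le_rfl).sub_const (f 0))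
    ((htendsto (-1) le_rfl (by norm_num)).const_sub (f x))
    (fun n => by simpa [sub_eq_add_neg] using hstep n)
  simp only [zero_mul, sub_self, neg_mul, one_mul] at h
  linarith

/-- a continuous weight satisfying condition (C') is even and convex in the
first argument. -/
theorem stmt18 (a : ℝ → ℝ → ℝ) (ha : Weight a) (hC : CondC' a) :
    ∀ v : ℝ, 0 ≤ v → (∀ x ∈ Icc (-1 : ℝ) 1, a (-x) v = a x v) ∧
      ConvexOn ℝ (Icc (-1 : ℝ) 1) (fun x => a x v) := by
  intro v hv
  have hf : ContinuousOn (fun x => a x v) (Icc (-1) 1) :=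
    ha.1.comp (f := fun x : ℝ => (x, v)) (by fun_prop) fun x hx => ⟨hx, hv⟩
  have hle : ∀ x ∈ Icc (-1 : ℝ) 1, a (-x) v ≤ a x v := fun x hx =>
    apply_neg_le_of_continuousOn hf (fun s hs t ht => hC s t v hs ht hv) hx
  have hneg : ∀ x ∈ Icc (-1 : ℝ) 1, -x ∈ Icc (-1 : ℝ) 1 := fun x hx =>
    ⟨neg_le_neg hx.2, by linarith [hx.1]⟩
  have heven : ∀ x ∈ Icc (-1 : ℝ) 1, a (-x) v = a x v := fun x hx =>
    (hle x hx).antisymm (by simpa using hle (-x) (hneg x hx))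
  refine ⟨heven, convexOn_of_midpoint_of_continuousOn (convex_Icc _ _) hf fun s hs t ht => ?_⟩
  have h := hC s (-t) v hs (hneg t ht) hv
  rw [heven t ht, show (s - -t) / 2 = (s + t) / 2 by ring,
    show (-t - s) / 2 = -((s + t) / 2) by ring,
    heven _ ⟨by linarith [hs.1, ht.1], by linarith [hs.2, ht.2]⟩] at h
  linarith
end
end
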